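/- Let λ ∈ P^+, 0 < a ≤ 1 rational, and let ν = ν_s, …, ν_0 = μ be an a-chain for (μ, ν) with roots β_1, …, β_s. Suppose that for some l with 1 ≤ l ≤ s, β_l = wα_i with w ∈ W and i ∈ I^{im}, and that aα_i^∨(μ) = 1 − a_{ii}. Then β_l = α_i, r_i commutes with r_{β_q} for all 1 ≤ q < l, μ = r_iμ' where μ' := r_{β_1}⋯r_{β_{l−1}}ν_l, and there exists an a-chain for the pair (μ', ν). -/

import Mathlib

namespace GKM

variable {I V : Type*} [AddCommGroup V] [Module ℚ V]

/-- The simple "reflection" `r_i : x ↦ x - α_i^∨(x) • α_i` (an endomorphism of `h*`). -/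
def srefl (α : I → V) (coroot : I → (V →ₗ[ℚ] ℚ)) (i : I) : Module.End ℚ V :=
  LinearMap.id - (coroot i).smulRight (α i)

/-- The dual map `h ↦ h - h(α_i) • α_i^∨` on linear functionals; for a real index `i`
this is `r_i^∨ : h ↦ h ∘ r_i⁻¹ = h ∘ r_i`. -/
def crefl (α : I → V) (coroot : I → (V →ₗ[ℚ] ℚ)) (i : I) :
    Module.End ℚ (V →ₗ[ℚ] ℚ) :=
  LinearMap.id - (LinearMap.applyₗ (α i)).smulRight (coroot i)

/-- The monoid `T` generated by all the `r_i`, `i ∈ I`. -/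
def Tmon (α : I → V) (coroot : I → (V →ₗ[ℚ] ℚ)) : Submonoid (Module.End ℚ V) :=
  Submonoid.closure (Set.range (srefl α coroot))

/-- The Weyl group `W` generated by the `r_i` with `i` real; since each generator is an
involution, the submonoid it generates coincides with the group it generates. -/
def Wmon (A : I → I → ℤ) (α : I → V) (coroot : I → (V →ₗ[ℚ] ℚ)) :
    Submonoid (Module.End ℚ V) :=
  Submonoid.closure (srefl α coroot '' {i | A i i = 2})

/-- `Q^+`, the set of `ℕ`-linear combinations of simple roots. -/
def Qplus (α : I → V) : Set V :=
  {x | ∃ c : I →₀ ℕ, x = c.sum fun i n => (n : ℚ) • α i}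

/-- The weight lattice `P`. -/
def Pint (coroot : I → (V →ₗ[ℚ] ℚ)) : Set V :=
  {x | ∀ i, ∃ n : ℤ, coroot i x = (n : ℚ)}

/-- The dominant integral weights `P^+`. -/
def Pplus (coroot : I → (V →ₗ[ℚ] ℚ)) : Set V :=
  {x | (∀ i, ∃ n : ℤ, coroot i x = (n : ℚ)) ∧ ∀ i, 0 ≤ coroot i x}

/-- The orbit `Tλ`. -/
def Torbit (α : I → V) (coroot : I → (V →ₗ[ℚ] ℚ)) (lam : V) : Set V :=
  {x | ∃ τ, τ ∈ Tmon α coroot ∧ τ lam = x}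

/-- The reduced length of `τ ∈ T` with respect to all generators `r_i`, `i ∈ I`. -/
noncomputable def lenT (α : I → V) (coroot : I → (V →ₗ[ℚ] ℚ))
    (τ : Module.End ℚ V) : ℕ :=
  sInf {n | ∃ l : List I, l.length = n ∧ (l.map (srefl α coroot)).prod = τ}

/-- The reduced length of `w ∈ W` with respect to the real generators. -/
noncomputable def lenW (A : I → I → ℤ) (α : I → V) (coroot : I → (V →ₗ[ℚ] ℚ))
    (w : Module.End ℚ V) : ℕ :=
  sInf {n | ∃ l : List I, (∀ m ∈ l, A m m = 2) ∧ l.length = n ∧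
    (l.map (srefl α coroot)).prod = w}

/-- The reflection `r_β : x ↦ x - β^∨(x) • β` attached to a root/coroot pair. -/
def reflRoot (β : V) (βv : V →ₗ[ℚ] ℚ) : Module.End ℚ V :=
  LinearMap.id - βv.smulRight β

/-- A presentation of `β = w α_k ∈ WΠ` together with its coroot `β^∨ = w^∨ α_k^∨`,
via a word `l` (with real entries) for `w`. -/
def IsWRootPres (A : I → I → ℤ) (α : I → V) (coroot : I → (V →ₗ[ℚ] ℚ))
    (l : List I) (k : I) (β : V) (βv : V →ₗ[ℚ] ℚ) : Prop :=
  (∀ m ∈ l, A m m = 2) ∧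
  β = (l.map (srefl α coroot)).prod (α k) ∧
  βv = (l.map (crefl α coroot)).prod (coroot k)

/-- `β ∈ WΠ` with coroot `β^∨`. -/
def IsWRootPair (A : I → I → ℤ) (α : I → V) (coroot : I → (V →ₗ[ℚ] ℚ))
    (β : V) (βv : V →ₗ[ℚ] ℚ) : Prop :=
  ∃ l k, IsWRootPres A α coroot l k β βv

/-- A chain `ν =: c s ← ⋯ ← c 0 := μ` of length `s` inside `Tλ`:
`c k = r_{β k} (c (k+1))` with `β k ∈ WΠ ∩ Q^+` and `(β k)^∨(c (k+1)) > 0`. -/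
def IsChain (A : I → I → ℤ) (α : I → V) (coroot : I → (V →ₗ[ℚ] ℚ))
    (lam μ ν : V) (s : ℕ) (c : ℕ → V) (β : ℕ → V)
    (βv : ℕ → (V →ₗ[ℚ] ℚ)) : Prop :=
  c 0 = μ ∧ c s = ν ∧ (∀ k ≤ s, c k ∈ Torbit α coroot lam) ∧
  ∀ k < s, IsWRootPair A α coroot (β k) (βv k) ∧ β k ∈ Qplus α ∧
    0 < βv k (c (k+1)) ∧ c k = c (k+1) - βv k (c (k+1)) • β k

/-- `μ > ν` in `Tλ`. -/
def ChainGT (A : I → I → ℤ) (α : I → V) (coroot : I → (V →ₗ[ℚ] ℚ))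
    (lam μ ν : V) : Prop :=
  ∃ s, 1 ≤ s ∧ ∃ c β βv, IsChain A α coroot lam μ ν s c β βv

/-- `dist(μ, ν) = n`: there is a chain of length `n` from `μ` to `ν` and every chain
has length at most `n`. -/
def distEq (A : I → I → ℤ) (α : I → V) (coroot : I → (V →ₗ[ℚ] ℚ))
    (lam μ ν : V) (n : ℕ) : Prop :=
  (∃ c β βv, IsChain A α coroot lam μ ν n c β βv) ∧
  ∀ m c β βv, IsChain A α coroot lam μ ν m c β βv → m ≤ n

/-- An `a`-chain for `(μ, ν)`: a chain in which each step is a covering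
(`dist = 1`), `a·β_k^∨(ν_k)` is a positive integer for steps along `WΠ_re`,
and `a·β_k^∨(ν_k) = 1` for steps along `WΠ_im`.  The index `ks k` records the simple
root of which `β k` is a `W`-translate. -/
def IsAChain (A : I → I → ℤ) (α : I → V) (coroot : I → (V →ₗ[ℚ] ℚ))
    (lam : V) (a : ℚ) (μ ν : V) (s : ℕ) (c : ℕ → V)
    (β : ℕ → V) (βv : ℕ → (V →ₗ[ℚ] ℚ)) (ks : ℕ → I) : Prop :=
  1 ≤ s ∧ IsChain A α coroot lam μ ν s c β βv ∧
  ∀ k < s,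
    (∃ l, IsWRootPres A α coroot l (ks k) (β k) (βv k)) ∧
    distEq A α coroot lam (c k) (c (k+1)) 1 ∧
    (A (ks k) (ks k) = 2 → ∃ n : ℕ, 0 < n ∧ a * βv k (c (k+1)) = (n : ℚ)) ∧
    (A (ks k) (ks k) ≠ 2 → a * βv k (c (k+1)) = 1)

/-- Existence of an `a`-chain for `(μ, ν)`. -/
def HasAChain (A : I → I → ℤ) (α : I → V) (coroot : I → (V →ₗ[ℚ] ℚ))
    (lam : V) (a : ℚ) (μ ν : V) : Prop :=
  ∃ s c β βv ks, IsAChain A α coroot lam a μ ν s c β βv ks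

/-- The piecewise-linear path attached to GLS data `(λ_1, …, λ_s ; a_0, …, a_s)`
(weights indexed `1, …, s`, breakpoints indexed `0, …, s`):
on `[a_{j-1}, a_j]` it equals `Σ_{k<j} (a_k - a_{k-1}) • λ_k + (t - a_{j-1}) • λ_j`. -/
def glsPath (lamseq : ℕ → V) (a : ℕ → ℚ) (s : ℕ) (t : ℚ) : V :=
  ∑ k ∈ Finset.range s, (max (min t (a (k+1)) - a k) 0) • lamseq (k+1)

/-- The data of a Generalized Lakshmibai–Seshadri path of shape `lam`. -/
def IsGLS (A : I → I → ℤ) (α : I → V) (coroot : I → (V →ₗ[ℚ] ℚ))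
    (lam : V) (s : ℕ) (lamseq : ℕ → V) (a : ℕ → ℚ) : Prop :=
  1 ≤ s ∧ a 0 = 0 ∧ a s = 1 ∧ (∀ k < s, a k < a (k+1)) ∧
  (∀ k, 1 ≤ k → k ≤ s → lamseq k ∈ Torbit α coroot lam) ∧
  (∀ k, 1 ≤ k → k < s →
    HasAChain A α coroot lam (a k) (lamseq k) (lamseq (k+1))) ∧
  (lamseq s = lam ∨ HasAChain A α coroot lam 1 (lamseq s) lam)

/-- The set `ℙ_λ` of Generalized Lakshmibai–Seshadri paths of shape `lam`,
realized as functions `ℚ → V` via `glsPath`. -/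
def GLSset (A : I → I → ℤ) (α : I → V) (coroot : I → (V →ₗ[ℚ] ℚ))
    (lam : V) : Set (ℚ → V) :=
  {π | ∃ s lamseq a, IsGLS A α coroot lam s lamseq a ∧ π = glsPath lamseq a s}

/-- `h_i^π(t) = α_i^∨(π(t))`. -/
def hFun (coroot : I → (V →ₗ[ℚ] ℚ)) (i : I) (π : ℚ → V) (t : ℚ) : ℚ :=
  coroot i (π t)

/-- `m_i^π`, the minimal integer value attained by `h_i^π` on `[0,1]`. -/
noncomputable def mOf (coroot : I → (V →ₗ[ℚ] ℚ)) (i : I) (π : ℚ → V) : ℤ :=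
  sInf {n : ℤ | ∃ t, 0 ≤ t ∧ t ≤ 1 ∧ hFun coroot i π t = (n : ℚ)}

/-- Two paths agree on `[0,1]`. -/
def pathEq (π π' : ℚ → V) : Prop := ∀ t, 0 ≤ t → t ≤ 1 → π t = π' t

/-- `tp = f_+^i(π)`: the largest point of `[0,1]` where `h_i^π` equals `m_i^π`. -/
def IsFPlus (coroot : I → (V →ₗ[ℚ] ℚ)) (i : I) (π : ℚ → V) (tp : ℚ) : Prop :=
  0 ≤ tp ∧ tp ≤ 1 ∧ hFun coroot i π tp = (mOf coroot i π : ℚ) ∧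
  ∀ t, 0 ≤ t → t ≤ 1 → hFun coroot i π t = (mOf coroot i π : ℚ) → t ≤ tp

/-- `tm = f_-^i(π)`: the smallest point of `[tp,1]` where `h_i^π` equals `m_i^π + 1`. -/
def IsFMinus (coroot : I → (V →ₗ[ℚ] ℚ)) (i : I) (π : ℚ → V) (tp tm : ℚ) : Prop :=
  tp ≤ tm ∧ tm ≤ 1 ∧ hFun coroot i π tm = (mOf coroot i π : ℚ) + 1 ∧
  ∀ t, tp ≤ t → t ≤ 1 → hFun coroot i π t = (mOf coroot i π : ℚ) + 1 → tm ≤ t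

/-- The path `f_i π` (for cutting data `tp = f_+^i(π)`, `tm = f_-^i(π)`). -/
def fPath (α : I → V) (coroot : I → (V →ₗ[ℚ] ℚ)) (i : I) (tp tm : ℚ)
    (π : ℚ → V) (t : ℚ) : V :=
  if t ≤ tp then π t
  else if t ≤ tm then π tp + srefl α coroot i (π t - π tp)
  else π t - α i

/-- `π' = f_i π ≠ 0` (equality of paths on `[0,1]`). -/
def FRel (α : I → V) (coroot : I → (V →ₗ[ℚ] ℚ)) (i : I) (π π' : ℚ → V) : Prop :=
  ∃ tp tm, IsFPlus coroot i π tp ∧ tp < 1 ∧ IsFMinus coroot i π tp tm ∧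
    pathEq π' (fPath α coroot i tp tm π)

/-- `tp = e_+^i(π)` (`i` real): smallest point of `[0,1]` where `h_i^π = m_i^π`. -/
def IsEPlusRe (coroot : I → (V →ₗ[ℚ] ℚ)) (i : I) (π : ℚ → V) (tp : ℚ) : Prop :=
  0 ≤ tp ∧ tp ≤ 1 ∧ hFun coroot i π tp = (mOf coroot i π : ℚ) ∧
  ∀ t, 0 ≤ t → t ≤ 1 → hFun coroot i π t = (mOf coroot i π : ℚ) → tp ≤ t

/-- `tm = e_-^i(π)` (`i` real): largest point of `[0,tp]` where `h_i^π = m_i^π + 1`. -/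
def IsEMinusRe (coroot : I → (V →ₗ[ℚ] ℚ)) (i : I) (π : ℚ → V) (tp tm : ℚ) : Prop :=
  0 ≤ tm ∧ tm ≤ tp ∧ hFun coroot i π tm = (mOf coroot i π : ℚ) + 1 ∧
  ∀ t, 0 ≤ t → t ≤ tp → hFun coroot i π t = (mOf coroot i π : ℚ) + 1 → t ≤ tm

/-- The path `e_i π` for `i` real. -/
def ePathRe (α : I → V) (coroot : I → (V →ₗ[ℚ] ℚ)) (i : I) (tm tp : ℚ)
    (π : ℚ → V) (t : ℚ) : V :=
  if t ≤ tm then π t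
  else if t ≤ tp then π tm + srefl α coroot i (π t - π tm)
  else π t + α i

/-- `π' = e_i π ≠ 0` for a real index `i`. -/
def ERelRe (α : I → V) (coroot : I → (V →ₗ[ℚ] ℚ)) (i : I) (π π' : ℚ → V) : Prop :=
  ∃ tp tm, IsEPlusRe coroot i π tp ∧ 0 < tp ∧ IsEMinusRe coroot i π tp tm ∧
    pathEq π' (ePathRe α coroot i tm tp π)

/-- The "inverse reflection" `r_i^{-1} : x ↦ x + (1/(1-a_{ii})) α_i^∨(x) α_i`
for an imaginary index `i`. -/
def rinv (A : I → I → ℤ) (α : I → V) (coroot : I → (V →ₗ[ℚ] ℚ)) (i : I) :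
    Module.End ℚ V :=
  LinearMap.id + (1 / (1 - (A i i : ℚ))) • (coroot i).smulRight (α i)

/-- `tp = e_+^i(π)` (`i` imaginary): smallest point of `[tm,1]` where
`h_i^π = m_i^π + 1 - a_{ii}` (here `tm = e_-^i(π) = f_+^i(π)`). -/
def IsEPlusIm (A : I → I → ℤ) (coroot : I → (V →ₗ[ℚ] ℚ)) (i : I) (π : ℚ → V)
    (tm tp : ℚ) : Prop :=
  tm ≤ tp ∧ tp ≤ 1 ∧
  hFun coroot i π tp = (mOf coroot i π : ℚ) + 1 - (A i i : ℚ) ∧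
  ∀ t, tm ≤ t → t ≤ 1 →
    hFun coroot i π t = (mOf coroot i π : ℚ) + 1 - (A i i : ℚ) → tp ≤ t

/-- The path `e_i π` for `i` imaginary. -/
def ePathIm (A : I → I → ℤ) (α : I → V) (coroot : I → (V →ₗ[ℚ] ℚ)) (i : I)
    (tm tp : ℚ) (π : ℚ → V) (t : ℚ) : V :=
  if t ≤ tm then π t
  else if t ≤ tp then π tm + rinv A α coroot i (π t - π tm)
  else π t + α i

/-- `π' = e_i π ≠ 0` for an imaginary index `i`:  `e_-^i(π) = f_+^i(π) < 1`, the point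
`e_+^i(π)` exists, and `h_i^π` never drops to `m_i^π - a_{ii}` on `[e_+^i(π), 1]`. -/
def ERelIm (A : I → I → ℤ) (α : I → V) (coroot : I → (V →ₗ[ℚ] ℚ)) (i : I)
    (π π' : ℚ → V) : Prop :=
  ∃ tm tp, IsFPlus coroot i π tm ∧ tm < 1 ∧ IsEPlusIm A coroot i π tm tp ∧
    (∀ t, tp ≤ t → t ≤ 1 →
      (mOf coroot i π : ℚ) - (A i i : ℚ) < hFun coroot i π t) ∧
    pathEq π' (ePathIm A α coroot i tm tp π)

/-- `π' = e_i π ≠ 0`. -/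
def ERel (A : I → I → ℤ) (α : I → V) (coroot : I → (V →ₗ[ℚ] ℚ)) (i : I)
    (π π' : ℚ → V) : Prop :=
  (A i i = 2 ∧ ERelRe α coroot i π π') ∨ (A i i ≠ 2 ∧ ERelIm A α coroot i π π')

/-- `π' = f_{i_1} ⋯ f_{i_k} π ≠ 0` for a list `[i_1, …, i_k]` (rightmost acts first). -/
def FMonRel (α : I → V) (coroot : I → (V →ₗ[ℚ] ℚ)) :
    List I → (ℚ → V) → (ℚ → V) → Prop
  | [], π, π' => pathEq π π'
  | i :: l, π, π' => ∃ πm, FMonRel α coroot l π πm ∧ FRel α coroot i πm π'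

/-- A generalized crystal for the Borcherds–Cartan datum `(A, α, coroot)`. -/
structure GenCrystal (A : I → I → ℤ) (α : I → V)
    (coroot : I → (V →ₗ[ℚ] ℚ)) where
  B : Type*
  wt : B → V
  wt_int : ∀ (i : I) (b : B), ∃ n : ℤ, coroot i (wt b) = (n : ℚ)
  eps : I → B → WithBot ℤ
  phi : I → B → WithBot ℤ
  e : I → B → Option B
  f : I → B → Option B
  phi_eq : ∀ (i : I) (b : B) (n : ℤ), (n : ℚ) = coroot i (wt b) →
    phi i b = eps i b + (n : WithBot ℤ)
  wt_e : ∀ (i : I) (b b' : B), e i b = some b' → wt b' = wt b + α i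
  eps_e_re : ∀ (i : I) (b b' : B), A i i = 2 → e i b = some b' →
    eps i b' = eps i b + ((-1 : ℤ) : WithBot ℤ)
  eps_e_im : ∀ (i : I) (b b' : B), A i i ≠ 2 → e i b = some b' →
    eps i b' = eps i b
  e_iff_f : ∀ (i : I) (b b' : B), e i b = some b' ↔ f i b' = some b
  phi_bot : ∀ (i : I) (b : B), phi i b = ⊥ → e i b = none ∧ f i b = none
  eps_im : ∀ (i : I) (b : B), A i i ≠ 2 → eps i b ≤ 0
  phi_im : ∀ (i : I) (b : B), A i i ≠ 2 → phi i b = ⊥ ∨ 0 ≤ phi i b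

/-- Finite "orthogonal" subsets of the imaginary simple roots, encoded by their
index sets: `F ∈ 𝒫(Π_im)`. -/
def PImSet (A : I → I → ℤ) (F : Finset I) : Prop :=
  (∀ i ∈ F, A i i ≠ 2) ∧ ∀ i ∈ F, ∀ j ∈ F, i ≠ j → A i j = 0

end GKM

namespace GKM

variable {I V : Type*} [AddCommGroup V] [Module ℚ V]

/-- The standing hypotheses on a Borcherds–Cartan matrix together with its simple roots
and coroots. -/
structure IsRealization (A : I → I → ℤ) (α : I → V) (coroot : I → (V →ₗ[ℚ] ℚ)) : Prop where
  linearIndependent : LinearIndependent ℚ α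
  pairing : ∀ i j, coroot i (α j) = (A i j : ℚ)
  diag : ∀ i, A i i = 2 ∨ A i i ≤ 0
  nonpos : ∀ i j, i ≠ j → A i j ≤ 0
  zero_iff : ∀ i j, A i j = 0 ↔ A j i = 0

/-- The real indices. -/
abbrev RealIndex (A : I → I → ℤ) : Type _ := {i // A i i = 2}

/-- The cone of `ℕ`-linear combinations of real simple roots. -/
def realCone (A : I → I → ℤ) (α : I → V) : AddSubmonoid V :=
  AddSubmonoid.closure (Set.range fun j : RealIndex A => α j)

theorem simple_mem_realCone {I V : Type*} [AddCommGroup V] {A : I → I → ℤ} (α : I → V)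
    (j : RealIndex A) :
    α j ∈ realCone A α :=
  AddSubmonoid.subset_closure ⟨j, rfl⟩

namespace IsRealization

variable {A : I → I → ℤ} {α : I → V} {coroot : I → (V →ₗ[ℚ] ℚ)}
  (D : IsRealization A α coroot)

/-! ### Real reflections and the length filtration of the Weyl group -/

/-- The simple reflection at a real index, as a linear automorphism. -/
noncomputable def s (j : RealIndex A) : V ≃ₗ[ℚ] V :=
  Module.reflection (x := α j) (f := coroot j) (by rw [D.pairing, j.2]; norm_num)

theorem s_apply (j : RealIndex A) (x : V) : D.s j x = x - coroot j x • α j := rfl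

theorem s_mul_self (j : RealIndex A) : D.s j * D.s j = 1 := by
  ext x
  exact Module.involutive_reflection _ x

theorem mul_s_mul_s (w : V ≃ₗ[ℚ] V) (j : RealIndex A) : w * D.s j * D.s j = w := by
  rw [mul_assoc, s_mul_self, mul_one]

theorem s_simple (j : RealIndex A) : D.s j (α j) = -α j := by
  rw [s_apply, D.pairing, j.2]; module

theorem s_apply_simple (j k : RealIndex A) : D.s j (α k) = α k - (A j k : ℚ) • α j := by
  rw [s_apply, D.pairing]

/-- The elements of the Weyl group of length at most `n`. -/
def ball (D : IsRealization A α coroot) : ℕ → Set (V ≃ₗ[ℚ] V)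
  | 0 => {1}
  | n + 1 => {w | w ∈ ball D n ∨ ∃ j, w * D.s j ∈ ball D n}

theorem ball_mono : Monotone D.ball :=
  monotone_nat_of_le_succ fun _ _ hw => Or.inl hw

theorem mul_s_mem_ball {n : ℕ} {w : V ≃ₗ[ℚ] V} (hw : w ∈ D.ball n) (j : RealIndex A) :
    w * D.s j ∈ D.ball (n + 1) :=
  Or.inr ⟨j, by rwa [mul_s_mul_s]⟩

theorem mul_prod_mem_ball (l : List (RealIndex A)) {n : ℕ} {w : V ≃ₗ[ℚ] V}
    (hw : w ∈ D.ball n) : w * (l.map D.s).prod ∈ D.ball (n + l.length) := by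
  induction l generalizing n w with
  | nil => simpa using hw
  | cons j l ih =>
    have := ih (D.mul_s_mem_ball hw j)
    simpa [mul_assoc, add_assoc, add_comm 1] using this

/-! ### Rank two -/

/-- `Alternating j t k y z u`: `u` is the alternating product of `k` factors in `s j` and `s t`
with last factor `s t` and first factor `s z`, and `y` is the index different from `z`. -/
inductive Alternating (j t : RealIndex A) :
    ℕ → RealIndex A → RealIndex A → (V ≃ₗ[ℚ] V) → Prop
  | base : Alternating j t 1 j t (D.s t)
  | step {k y z u} : Alternating j t k y z u → Alternating j t (k + 1) z y (D.s y * u)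

variable {D} in
theorem Alternating.eq_or {j t y z : RealIndex A} {k : ℕ} {u : V ≃ₗ[ℚ] V}
    (h : D.Alternating j t k y z u) :
    (¬Even k ∧ y = j ∧ z = t) ∨ (Even k ∧ y = t ∧ z = j) := by
  induction h with
  | base => simp
  | step _ ih => simp only [Nat.even_add_one]; tauto

variable {D} in
theorem Alternating.exists_list {j t y z : RealIndex A} {k : ℕ} {u : V ≃ₗ[ℚ] V}
    (h : D.Alternating j t k y z u) : ∃ l : List (RealIndex A), l.length = k ∧
      (l.map D.s).prod = u := by
  induction h with
  | base => exact ⟨[t], rfl, by simp⟩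
  | @step k y z u _ ih =>
    obtain ⟨l, hl, rfl⟩ := ih
    exact ⟨y :: l, by simp [hl], by simp⟩

/-- `u * s j` can be written with fewer than `k` factors. -/
def Shortens (j : RealIndex A) (k : ℕ) (u : V ≃ₗ[ℚ] V) : Prop :=
  ∃ l : List (RealIndex A), l.length < k ∧ (l.map D.s).prod = u * D.s j

variable {D} in
theorem Shortens.s_mul {j : RealIndex A} {k : ℕ} {u : V ≃ₗ[ℚ] V} (h : D.Shortens j k u)
    (y : RealIndex A) : D.Shortens j (k + 1) (D.s y * u) := by
  obtain ⟨l, hl, h⟩ := h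
  exact ⟨y :: l, by simpa using hl, by simp [h, mul_assoc]⟩

/-- `x` is an `ℕ`-linear combination of two simple roots. -/
def InSpan (α : I → V) (j t : RealIndex A) (x : V) : Prop :=
  ∃ p q : ℕ, x = (p : ℚ) • α j + (q : ℚ) • α t

theorem InSpan.of_int {j t : RealIndex A} {x : V} (p q : ℤ) (hp : 0 ≤ p) (hq : 0 ≤ q)
    (h : x = (p : ℚ) • α j + (q : ℚ) • α t) : InSpan α j t x := by
  lift p to ℕ using hp
  lift q to ℕ using hq
  exact ⟨p, q, by simpa using h⟩

theorem Alternating.inSpan_of_four_le {j t y z : RealIndex A} (hjt : j ≠ t)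
    (h4 : 4 ≤ A j t * A t j) {k : ℕ} {u : V ≃ₗ[ℚ] V} (h : D.Alternating j t k y z u) :
    InSpan α j t (u (α j)) := by
  have hneg : A j t ≤ 0 ∧ A t j ≤ 0 :=
    ⟨D.nonpos _ _ (Subtype.coe_injective.ne hjt), D.nonpos _ _ (Subtype.coe_injective.ne hjt.symm)⟩
  have key : ∃ p q : ℤ, 0 ≤ p ∧ 0 ≤ q ∧ -A z y * p ≤ 2 * q ∧
      u (α j) = (p : ℚ) • α y + (q : ℚ) • α z := by
    induction h with
    | base =>
      refine ⟨1, -A t j, by norm_num, by omega, by omega, ?_⟩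
      rw [s_apply_simple]; push_cast; module
    | @step k y z u h ih =>
      obtain ⟨p, q, hp, hq, hpq, hu⟩ := ih
      have hyz : A y z ≤ 0 ∧ 4 ≤ A y z * A z y := by
        rcases h.eq_or with ⟨-, rfl, rfl⟩ | ⟨-, rfl, rfl⟩
        · exact ⟨hneg.1, h4⟩
        · exact ⟨hneg.2, by linarith [mul_comm (A y z) (A z y)]⟩
      have h2 : 2 * p ≤ -A y z * q := by nlinarith
      refine ⟨q, -A y z * q - p, hq, by linarith, by linarith, ?_⟩
      rw [LinearEquiv.mul_apply, hu, map_add, map_smul, map_smul, s_simple, s_apply_simple]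
      push_cast; module
  obtain ⟨p, q, hp, hq, -, hu⟩ := key
  rcases h.eq_or with ⟨-, rfl, rfl⟩ | ⟨-, rfl, rfl⟩
  · exact .of_int p q hp hq hu
  · exact .of_int q p hq hp (by rw [hu, add_comm])

theorem braid_two {j t : RealIndex A} (h1 : A j t = 0) (h2 : A t j = 0) :
    D.s j * D.s t = D.s t * D.s j := by
  have e1 := D.pairing j t; have e2 := D.pairing t j
  rw [h1] at e1; rw [h2] at e2
  ext x
  simp only [LinearEquiv.mul_apply, s_apply, map_sub, map_smul, e1, e2]
  push_cast; module

theorem braid_three {j t : RealIndex A} (h1 : A j t = -1) (h2 : A t j = -1) :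
    D.s t * D.s j * D.s t = D.s j * D.s t * D.s j := by
  have e1 := D.pairing j t; have e2 := D.pairing t j
  have e3 := D.pairing j j; have e4 := D.pairing t t
  rw [h1] at e1; rw [h2] at e2; rw [j.2] at e3; rw [t.2] at e4
  ext x
  simp only [LinearEquiv.mul_apply, s_apply, map_sub, map_smul, e1, e2, e3, e4]
  push_cast; module

theorem braid_four {j t : RealIndex A} (h : A j t * A t j = 2) :
    D.s j * D.s t * D.s j * D.s t = D.s t * D.s j * D.s t * D.s j := by
  have e1 := D.pairing j t; have e2 := D.pairing t j
  have e3 := D.pairing j j; have e4 := D.pairing t t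
  rw [j.2] at e3; rw [t.2] at e4
  have h' : (A j t : ℚ) * A t j = 2 := by exact_mod_cast h
  ext x
  simp only [LinearEquiv.mul_apply, s_apply, map_sub, map_smul, e1, e2, e3, e4]
  push_cast
  match_scalars
  · ring
  · linear_combination (coroot t x * A j t) * h'
  · linear_combination (-coroot j x * A t j) * h'

theorem braid_six {j t : RealIndex A} (h : A j t * A t j = 3) :
    D.s j * D.s t * D.s j * D.s t * D.s j * D.s t =
      D.s t * D.s j * D.s t * D.s j * D.s t * D.s j := by
  have e1 := D.pairing j t; have e2 := D.pairing t j
  have e3 := D.pairing j j; have e4 := D.pairing t t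
  rw [j.2] at e3; rw [t.2] at e4
  have h' : (A j t : ℚ) * A t j = 3 := by exact_mod_cast h
  ext x
  simp only [LinearEquiv.mul_apply, s_apply, map_sub, map_smul, e1, e2, e3, e4]
  push_cast
  match_scalars
  · ring
  · linear_combination (coroot t x * A j t) * (A j t * A t j - 1) * h'
  · linear_combination (-coroot j x * A t j) * (A j t * A t j - 1) * h'

/-- Coefficients of the images of a simple root under alternating products. -/
def alternatingCoeff (N : ℤ) : ℕ → ℤ × ℤ
  | 0 => (1, 0)
  | k + 1 =>
    if Even k then ((alternatingCoeff N k).1, (alternatingCoeff N k).1 - (alternatingCoeff N k).2)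
    else (N * (alternatingCoeff N k).2 - (alternatingCoeff N k).1, (alternatingCoeff N k).2)

variable {D} in
theorem Alternating.apply_simple {j t y z : RealIndex A} {k : ℕ} {u : V ≃ₗ[ℚ] V}
    (h : D.Alternating j t k y z u) :
    u (α j) = ((alternatingCoeff (A j t * A t j) k).1 : ℚ) • α j +
      ((-A t j * (alternatingCoeff (A j t * A t j) k).2 : ℤ) : ℚ) • α t := by
  induction h with
  | base =>
    rw [s_apply_simple]; simp [alternatingCoeff, sub_eq_add_neg]
  | @step k y z u h ih =>
    rw [LinearEquiv.mul_apply, ih, map_add, map_smul, map_smul, alternatingCoeff]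
    rcases h.eq_or with ⟨hk, rfl, rfl⟩ | ⟨hk, rfl, rfl⟩
    · rw [if_neg hk, s_simple, s_apply_simple]; push_cast; module
    · rw [if_pos hk, s_simple, s_apply_simple]; push_cast; module

variable {D} in
theorem Alternating.lt_or_shortens {j t y z : RealIndex A} {k m : ℕ} {u : V ≃ₗ[ℚ] V} (h1 : 1 < m)
    (hm : ∀ y z u, D.Alternating j t m y z u → D.Shortens j m u)
    (h : D.Alternating j t k y z u) : k < m ∨ D.Shortens j k u := by
  induction h with
  | base => exact .inl h1
  | @step k y z u h ih =>
    rcases ih with hk | hk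
    · rcases (Nat.succ_le_of_lt hk).lt_or_eq with hk | rfl
      · exact .inl hk
      · exact .inr (hm _ _ _ h.step)
    · exact .inr (hk.s_mul y)

variable {D} in
theorem Alternating.inSpan_or_shortens_of_braid {j t y z : RealIndex A} {k m : ℕ}
    {u : V ≃ₗ[ℚ] V} (hjt : j ≠ t) (h1 : 1 < m)
    (hm : ∀ y z u, D.Alternating j t m y z u → D.Shortens j m u)
    (hpos : ∀ k < m, 0 ≤ (alternatingCoeff (A j t * A t j) k).1 ∧
      (0 ≤ (alternatingCoeff (A j t * A t j) k).2 ∨ A t j = 0))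
    (h : D.Alternating j t k y z u) : InSpan α j t (u (α j)) ∨ D.Shortens j k u := by
  refine (h.lt_or_shortens h1 hm).imp_left fun hk => ?_
  refine .of_int _ _ (hpos k hk).1 ?_ h.apply_simple
  rcases (hpos k hk).2 with h | h
  · exact mul_nonneg (neg_nonneg.2 (D.nonpos _ _ (Subtype.coe_injective.ne hjt.symm))) h
  · simp [h]

theorem shortens_of_eq {j : RealIndex A} {k : ℕ} {u : V ≃ₗ[ℚ] V} (l : List (RealIndex A))
    (hl : l.length < k) (h : u = (l.map D.s).prod * D.s j) : D.Shortens j k u :=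
  ⟨l, hl, by rw [h, mul_s_mul_s]⟩

variable {D} in
theorem Alternating.inSpan_or_shortens {j t y z : RealIndex A} {k : ℕ} {u : V ≃ₗ[ℚ] V}
    (hjt : j ≠ t) (h : D.Alternating j t k y z u) :
    InSpan α j t (u (α j)) ∨ D.Shortens j k u := by
  have hneg : A j t ≤ 0 ∧ A t j ≤ 0 :=
    ⟨D.nonpos _ _ (Subtype.coe_injective.ne hjt), D.nonpos _ _ (Subtype.coe_injective.ne hjt.symm)⟩
  rcases le_or_gt 4 (A j t * A t j) with h4 | h4
  · exact .inl (h.inSpan_of_four_le D hjt h4)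
  have h0 : 0 ≤ A j t * A t j := mul_nonneg_of_nonpos_of_nonpos hneg.1 hneg.2
  generalize hN : A j t * A t j = N at h0 h4
  interval_cases N
  · have ht : A t j = 0 := by
      rcases mul_eq_zero.1 hN with h | h
      · exact (D.zero_iff _ _).1 h
      · exact h
    refine h.inSpan_or_shortens_of_braid hjt (m := 2) (by norm_num) ?_ ?_
    · rintro _ _ _ (_ | @⟨_, _, _, _, _ | @⟨_, _, _, _, h⟩⟩)
      · exact D.shortens_of_eq [t] (by simp)
          (by simpa using D.braid_two ((D.zero_iff _ _).1 ht) ht)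
      · nomatch h
    · intro k hk
      rw [hN]
      interval_cases k <;> simp [alternatingCoeff, ht]
  · have h1 : A j t = -1 ∧ A t j = -1 := by
      have := Int.eq_one_or_neg_one_of_mul_eq_one' hN
      omega
    refine h.inSpan_or_shortens_of_braid hjt (m := 3) (by norm_num) ?_ ?_
    · rintro _ _ _ (_ | @⟨_, _, _, _, _ | @⟨_, _, _, _, _ | @⟨_, _, _, _, h⟩⟩⟩)
      · exact D.shortens_of_eq [j, t] (by simp)
          (by simpa [mul_assoc] using D.braid_three h1.1 h1.2)
      · nomatch h
    · intro k hk
      rw [hN]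
      interval_cases k <;> simp [alternatingCoeff]
  · refine h.inSpan_or_shortens_of_braid hjt (m := 4) (by norm_num) ?_ ?_
    · rintro _ _ _ (_ | @⟨_, _, _, _, _ | @⟨_, _, _, _, _ | @⟨_, _, _, _, _ |
        @⟨_, _, _, _, h⟩⟩⟩⟩)
      · exact D.shortens_of_eq [t, j, t] (by simp)
          (by simpa [mul_assoc] using D.braid_four hN)
      · nomatch h
    · intro k hk
      rw [hN]
      interval_cases k <;> simp [alternatingCoeff, Nat.even_iff]
  · refine h.inSpan_or_shortens_of_braid hjt (m := 6) (by norm_num) ?_ ?_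
    · rintro _ _ _ (_ | @⟨_, _, _, _, _ | @⟨_, _, _, _, _ | @⟨_, _, _, _, _ |
        @⟨_, _, _, _, _ | @⟨_, _, _, _, _ | @⟨_, _, _, _, h⟩⟩⟩⟩⟩⟩)
      · exact D.shortens_of_eq [t, j, t, j, t] (by simp)
          (by simpa [mul_assoc] using D.braid_six hN)
      · nomatch h
    · intro k hk
      rw [hN]
      interval_cases k <;> simp [alternatingCoeff, Nat.even_iff]

/-- If `w` has length `n` and `w * s j` is not shorter than `w`, then `w` sends `α j` to a
nonnegative combination of real simple roots. -/
theorem apply_simple_mem_realCone {n : ℕ} {w : V ≃ₗ[ℚ] V} {j : RealIndex A} (hw : w ∈ D.ball n)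
    (hmin : ∀ m < n, w ∉ D.ball m) (hj : ∀ m < n, w * D.s j ∉ D.ball m) :
    w (α j) ∈ realCone A α := by
  induction n using Nat.strong_induction_on generalizing w j with
  | _ n ih =>
  rcases n with _ | n
  · obtain rfl : w = 1 := hw
    exact simple_mem_realCone α j
  obtain ⟨t, ht⟩ : ∃ t, w * D.s t ∈ D.ball n := hw.resolve_left (hmin n n.lt_succ_self)
  have hjt : j ≠ t := by rintro rfl; exact hj n n.lt_succ_self ht
  suffices H : ∀ N k y z u v, D.Alternating j t k y z u → w = v * u → v ∈ D.ball N →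
      N + k = n + 1 → w (α j) ∈ realCone A α from
    H n 1 j t (D.s t) (w * D.s t) .base (D.mul_s_mul_s w t).symm ht rfl
  intro N
  induction N using Nat.strong_induction_on with
  | _ N ihN =>
  intro k y z u v hu hwv hv hNk
  have hk : 1 ≤ k := by cases hu <;> omega
  have hvmin : ∀ m < N, v ∉ D.ball m := by
    intro m hm hvm
    obtain ⟨l, hl, rfl⟩ := hu.exists_list
    exact hmin (m + k) (by omega) (hwv ▸ hl ▸ D.mul_prod_mem_ball l hvm)
  have hz : ∀ m < N, v * D.s z ∉ D.ball m := by
    intro m hm hvm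
    have : ∃ l : List (RealIndex A), l.length + 1 = k ∧ (l.map D.s).prod = D.s z * u := by
      cases hu with
      | base => exact ⟨[], rfl, by simp [s_mul_self]⟩
      | step h =>
        obtain ⟨l, hl, hl'⟩ := h.exists_list
        exact ⟨l, by rw [hl], by rw [hl', ← mul_assoc, s_mul_self, one_mul]⟩
    obtain ⟨l, hl, hl'⟩ := this
    refine hmin (m + l.length) (by omega) ?_
    have := D.mul_prod_mem_ball l hvm
    rwa [hl', ← mul_assoc, mul_s_mul_s, ← hwv] at this
  by_cases hy : ∃ m < N, v * D.s y ∈ D.ball m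
  · obtain ⟨m, hm, hvm⟩ := hy
    refine ihN (N - 1) (by omega) (k + 1) z y (D.s y * u) (v * D.s y) hu.step ?_
      (D.ball_mono (by omega) hvm) (by omega)
    rw [← mul_assoc, mul_s_mul_s, hwv]
  · have hy : ∀ m < N, v * D.s y ∉ D.ball m := by simpa using hy
    have hcone : v (α j) ∈ realCone A α ∧ v (α t) ∈ realCone A α := by
      have h1 := ih N (by omega) hv hvmin hy
      have h2 := ih N (by omega) hv hvmin hz
      rcases hu.eq_or with ⟨-, rfl, rfl⟩ | ⟨-, rfl, rfl⟩
      · exact ⟨h1, h2⟩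
      · exact ⟨h2, h1⟩
    rcases hu.inSpan_or_shortens hjt with ⟨p, q, h⟩ | ⟨l, hl, h⟩
    · rw [hwv, LinearEquiv.mul_apply, h, map_add, map_smul, map_smul, Nat.cast_smul_eq_nsmul,
        Nat.cast_smul_eq_nsmul]
      exact add_mem (nsmul_mem hcone.1 p) (nsmul_mem hcone.2 q)
    · refine absurd ?_ (hj (N + l.length) (by omega))
      rw [hwv, mul_assoc, ← h]
      exact D.mul_prod_mem_ball l hv

end IsRealization
end GKM

namespace GKM

variable {I V : Type*} [AddCommGroup V] [Module ℚ V]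

/-- The cone of `ℕ`-linear combinations of simple roots. -/
def posCone {I V : Type*} [AddCommGroup V] (α : I → V) : AddSubmonoid V :=
  AddSubmonoid.closure (Set.range α)

theorem realCone_le_posCone {I V : Type*} [AddCommGroup V] (A : I → I → ℤ) (α : I → V) :
    realCone A α ≤ posCone α :=
  AddSubmonoid.closure_mono (by rintro _ ⟨j, rfl⟩; exact ⟨j, rfl⟩)

theorem simple_mem_posCone {I V : Type*} [AddCommGroup V] (α : I → V) (i : I) :
    α i ∈ posCone α :=
  AddSubmonoid.subset_closure ⟨i, rfl⟩

theorem mem_Qplus_iff {α : I → V} {x : V} : x ∈ Qplus α ↔ x ∈ posCone α := by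
  constructor
  · rintro ⟨c, rfl⟩
    refine sum_mem fun i _ => ?_
    show (c i : ℚ) • α i ∈ posCone α
    rw [Nat.cast_smul_eq_nsmul]
    exact nsmul_mem (simple_mem_posCone α i) _
  · intro hx
    induction hx using AddSubmonoid.closure_induction with
    | mem x hx =>
      obtain ⟨i, rfl⟩ := hx
      exact ⟨Finsupp.single i 1, by simp⟩
    | zero => exact ⟨0, by simp⟩
    | add x y _ _ hx hy =>
      obtain ⟨c, rfl⟩ := hx
      obtain ⟨d, rfl⟩ := hy
      refine ⟨c + d, ?_⟩
      classical
      rw [Finsupp.sum_add_index' (by simp) (by intros; push_cast; module)]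

namespace IsRealization

variable {A : I → I → ℤ} {α : I → V} {coroot : I → (V →ₗ[ℚ] ℚ)}
  (D : IsRealization A α coroot)

/-! ### The Weyl group -/

/-- The group generated by the real simple reflections. -/
def weyl : Subgroup (V ≃ₗ[ℚ] V) := Subgroup.closure (Set.range D.s)

theorem s_mem_weyl (j : RealIndex A) : D.s j ∈ D.weyl := Subgroup.subset_closure ⟨j, rfl⟩

theorem s_inv (j : RealIndex A) : (D.s j)⁻¹ = D.s j := inv_eq_of_mul_eq_one_left (D.s_mul_self j)

theorem exists_mem_ball {w : V ≃ₗ[ℚ] V} (hw : w ∈ D.weyl) : ∃ n, w ∈ D.ball n := by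
  induction hw using Subgroup.closure_induction_right with
  | one => exact ⟨0, rfl⟩
  | mul_right w _ y hy ih =>
    obtain ⟨j, rfl⟩ := hy
    obtain ⟨n, hn⟩ := ih
    exact ⟨n + 1, D.mul_s_mem_ball hn j⟩
  | mul_inv_cancel w _ y hy ih =>
    obtain ⟨j, rfl⟩ := hy
    obtain ⟨n, hn⟩ := ih
    exact ⟨n + 1, by rw [s_inv]; exact D.mul_s_mem_ball hn j⟩

theorem ball_subset_weyl (n : ℕ) : D.ball n ⊆ D.weyl := by
  induction n with
  | zero => rintro _ rfl; exact one_mem _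
  | succ n ih =>
    rintro w (hw | ⟨j, hw⟩)
    · exact ih hw
    · rw [← D.mul_s_mul_s w j]
      exact mul_mem (ih hw) (D.s_mem_weyl j)

theorem exists_length {w : V ≃ₗ[ℚ] V} {n : ℕ} (hw : w ∈ D.ball n) :
    ∃ k ≤ n, w ∈ D.ball k ∧ ∀ m < k, w ∉ D.ball m := by
  classical
  have h : ∃ n, w ∈ D.ball n := ⟨n, hw⟩
  exact ⟨Nat.find h, Nat.find_min' h hw, Nat.find_spec h, fun m hm => Nat.find_min h hm⟩

/-- Induction along reduced expressions. -/
theorem weyl_induction {P : (V ≃ₗ[ℚ] V) → Prop} (one : P 1)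
    (mul_s : ∀ w ∈ D.weyl, ∀ j : RealIndex A, w (α j) ∈ realCone A α → P w → P (w * D.s j))
    {w : V ≃ₗ[ℚ] V} (hw : w ∈ D.weyl) : P w := by
  obtain ⟨n, hn, hmin⟩ : ∃ n, w ∈ D.ball n ∧ ∀ m < n, w ∉ D.ball m := by
    obtain ⟨m, hm⟩ := D.exists_mem_ball hw
    obtain ⟨n, -, h⟩ := D.exists_length hm
    exact ⟨n, h⟩
  clear hw
  induction n generalizing w with
  | zero => obtain rfl : w = 1 := hn; exact one
  | succ n ih =>
    obtain ⟨j, hj⟩ := hn.resolve_left (hmin n n.lt_succ_self)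
    have hj' : ∀ m < n, w * D.s j ∉ D.ball m := fun m hm h =>
      hmin (m + 1) (by omega) (Or.inr ⟨j, h⟩)
    have := mul_s _ (D.ball_subset_weyl n hj) j
      (D.apply_simple_mem_realCone hj hj' fun m hm => by
        rw [mul_s_mul_s]; exact hmin m (by omega))
      (ih hj hj')
    rwa [mul_s_mul_s] at this

/-- Real roots are positive or negative. -/
theorem apply_simple_mem_or_neg_mem {w : V ≃ₗ[ℚ] V} (hw : w ∈ D.weyl) (j : RealIndex A) :
    w (α j) ∈ realCone A α ∨ -w (α j) ∈ realCone A α := by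
  obtain ⟨n, hn⟩ := D.exists_mem_ball hw
  obtain ⟨n, -, hn, hmin⟩ := D.exists_length hn
  by_cases h : ∃ m < n, w * D.s j ∈ D.ball m
  · obtain ⟨m, hm, h⟩ := h
    obtain ⟨k, hk, hk', hkmin⟩ := D.exists_length h
    have := D.apply_simple_mem_realCone hk' hkmin fun p hp => by
      rw [mul_s_mul_s]; exact hmin p (by omega)
    rw [LinearEquiv.mul_apply, s_simple, map_neg] at this
    exact .inr this
  · exact .inl (D.apply_simple_mem_realCone hn hmin (by simpa using h))

theorem apply_sub_mem_of_antidominant {x : V}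
    (hx : ∀ j : RealIndex A, ∃ n : ℕ, coroot j x = -(n : ℚ)) {w : V ≃ₗ[ℚ] V} (hw : w ∈ D.weyl) :
    w x - x ∈ realCone A α := by
  refine D.weyl_induction (P := fun w => w x - x ∈ realCone A α) ?_ (fun w _ j hj ih => ?_) hw
  · simp
  · obtain ⟨n, hn⟩ := hx j
    have : (w * D.s j) x - x = (w x - x) + n • w (α j) := by
      rw [LinearEquiv.mul_apply, s_apply, hn, map_sub, map_smul, ← Nat.cast_smul_eq_nsmul ℚ]
      module
    rw [this]
    exact add_mem ih (nsmul_mem hj n)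

/-! ### Heights and coordinates -/

theorem exists_dual (D : IsRealization A α coroot) (c : I → ℚ) :
    ∃ f : V →ₗ[ℚ] ℚ, ∀ i, f (α i) = c i := by
  obtain ⟨f, hf⟩ := LinearMap.exists_extend
    ((Module.Basis.span D.linearIndependent).constr ℚ c)
  refine ⟨f, fun i => ?_⟩
  have h := LinearMap.congr_fun hf (Module.Basis.span D.linearIndependent i)
  rw [Module.Basis.constr_basis] at h
  rw [← h, LinearMap.comp_apply, Submodule.subtype_apply, Module.Basis.span_apply]

/-- A linear functional taking the value one on every simple root. -/
noncomputable def height : V →ₗ[ℚ] ℚ := (D.exists_dual fun _ => 1).choose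

theorem height_simple (i : I) : D.height (α i) = 1 := (D.exists_dual fun _ => 1).choose_spec i

theorem exists_height_eq {x : V} (hx : x ∈ posCone α) : ∃ n : ℕ, D.height x = n := by
  induction hx using AddSubmonoid.closure_induction with
  | mem x hx => obtain ⟨i, rfl⟩ := hx; exact ⟨1, by simp [height_simple]⟩
  | zero => exact ⟨0, by simp⟩
  | add x y _ _ hx hy =>
    obtain ⟨m, hm⟩ := hx
    obtain ⟨n, hn⟩ := hy
    exact ⟨m + n, by simp [hm, hn]⟩

theorem height_nonneg {x : V} (hx : x ∈ posCone α) : 0 ≤ D.height x := by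
  obtain ⟨n, hn⟩ := D.exists_height_eq hx
  rw [hn]; positivity

theorem eq_zero_of_height_nonpos {x : V} (hx : x ∈ posCone α) (h : D.height x ≤ 0) : x = 0 := by
  induction hx using AddSubmonoid.closure_induction with
  | mem x hx => obtain ⟨i, rfl⟩ := hx; rw [height_simple] at h; norm_num at h
  | zero => rfl
  | add x y hx hy ihx ihy =>
    have h1 := D.height_nonneg hx
    have h2 := D.height_nonneg hy
    rw [map_add] at h
    rw [ihx (by linarith), ihy (by linarith), add_zero]

theorem eq_zero_of_neg_mem (D : IsRealization A α coroot) {x : V} (hx : x ∈ posCone α)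
    (h : -x ∈ posCone α) : x = 0 :=
  D.eq_zero_of_height_nonpos hx (by simpa using D.height_nonneg h)

theorem exists_int_coroot (D : IsRealization A α coroot) {x : V} (hx : x ∈ posCone α) (i : I) :
    ∃ n : ℤ, coroot i x = n := by
  induction hx using AddSubmonoid.closure_induction with
  | mem x hx => obtain ⟨k, rfl⟩ := hx; exact ⟨_, D.pairing i k⟩
  | zero => exact ⟨0, by simp⟩
  | add x y _ _ hx hy =>
    obtain ⟨m, hm⟩ := hx
    obtain ⟨n, hn⟩ := hy
    exact ⟨m + n, by simp [hm, hn]⟩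

theorem coroot_nonpos (D : IsRealization A α coroot) {i : I} (hi : A i i ≠ 2) {x : V}
    (hx : x ∈ posCone α) : coroot i x ≤ 0 := by
  induction hx using AddSubmonoid.closure_induction with
  | mem x hx =>
    obtain ⟨k, rfl⟩ := hx
    rw [D.pairing]
    by_cases h : i = k
    · subst h; exact_mod_cast (D.diag i).resolve_left hi
    · exact_mod_cast D.nonpos i k h
  | zero => simp
  | add x y _ _ hx hy => rw [map_add]; exact add_nonpos hx hy

theorem simple_ne_zero (D : IsRealization A α coroot) (i : I) : α i ≠ 0 :=
  D.linearIndependent.ne_zero i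

theorem apply_simple_ne_zero (D : IsRealization A α coroot) (w : V ≃ₗ[ℚ] V) (i : I) :
    w (α i) ≠ 0 := by
  simpa using D.simple_ne_zero i

/-! ### Translates of imaginary simple roots -/

theorem imaginary_ne_real {A : I → I → ℤ} {i : I} (hi : A i i ≠ 2) (j : RealIndex A) : i ≠ j := by
  rintro rfl; exact hi j.2

theorem apply_imaginary_sub_mem {i : I} (hi : A i i ≠ 2) {w : V ≃ₗ[ℚ] V} (hw : w ∈ D.weyl) :
    w (α i) - α i ∈ realCone A α := by
  refine D.apply_sub_mem_of_antidominant (fun j => ⟨(A j i).natAbs, ?_⟩) hw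
  have := D.nonpos j i (imaginary_ne_real hi j).symm
  rw [D.pairing, Nat.cast_natAbs, abs_of_nonpos this]
  push_cast; ring

theorem apply_imaginary_mem {i : I} (hi : A i i ≠ 2) {w : V ≃ₗ[ℚ] V} (hw : w ∈ D.weyl) :
    w (α i) ∈ posCone α := by
  have := add_mem (realCone_le_posCone A α (D.apply_imaginary_sub_mem hi hw))
    (simple_mem_posCone α i)
  rwa [sub_add_cancel] at this

theorem exists_descent {i : I} (hi : A i i ≠ 2) {w : V ≃ₗ[ℚ] V} (hw : w ∈ D.weyl)
    (hne : w (α i) ≠ α i) : ∃ j : RealIndex A, 0 < coroot j (w (α i)) := by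
  by_contra! h
  refine hne (sub_eq_zero.1 (D.eq_zero_of_neg_mem
    (realCone_le_posCone A α (D.apply_imaginary_sub_mem hi hw)) ?_))
  have := D.apply_sub_mem_of_antidominant (x := w (α i)) (fun j => ?_) (inv_mem hw)
  · rw [neg_sub]
    rw [← LinearEquiv.mul_apply, inv_mul_cancel] at this
    exact realCone_le_posCone A α this
  · obtain ⟨n, hn⟩ := D.exists_int_coroot (D.apply_imaginary_mem hi hw) j
    have hn0 : n ≤ 0 := by exact_mod_cast hn ▸ h j
    refine ⟨n.natAbs, ?_⟩
    rw [hn, Nat.cast_natAbs, abs_of_nonpos hn0]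
    push_cast; ring

/-- Induction on the height of a translate of an imaginary simple root. -/
theorem imaginary_descent {i : I} (hi : A i i ≠ 2) {P : (V ≃ₗ[ℚ] V) → Prop}
    (base : ∀ w ∈ D.weyl, w (α i) = α i → P w)
    (step : ∀ w ∈ D.weyl, ∀ j : RealIndex A, 0 < coroot j (w (α i)) → P (D.s j * w) → P w)
    {w : V ≃ₗ[ℚ] V} (hw : w ∈ D.weyl) : P w := by
  obtain ⟨n, hn⟩ := D.exists_height_eq (D.apply_imaginary_mem hi hw)
  induction n using Nat.strong_induction_on generalizing w with
  | _ n ih =>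
  by_cases h : w (α i) = α i
  · exact base w hw h
  obtain ⟨j, hj⟩ := D.exists_descent hi hw h
  have hw' := mul_mem (D.s_mem_weyl j) hw
  obtain ⟨m, hm⟩ := D.exists_height_eq (D.apply_imaginary_mem hi hw')
  refine step w hw j hj (ih m ?_ hw' hm)
  rw [LinearEquiv.mul_apply, s_apply, map_sub, map_smul, height_simple, hn, smul_eq_mul,
    mul_one] at hm
  have : (m : ℚ) < n := by linarith
  exact_mod_cast this

theorem coroot_apply_imaginary_le {i : I} (hi : A i i ≠ 2) {w : V ≃ₗ[ℚ] V} (hw : w ∈ D.weyl) :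
    coroot i (w (α i)) ≤ A i i := by
  have := D.coroot_nonpos hi (realCone_le_posCone A α (D.apply_imaginary_sub_mem hi hw))
  rw [map_sub, D.pairing] at this
  linarith

theorem apply_imaginary_eq {i : I} (hi : A i i ≠ 2) {w : V ≃ₗ[ℚ] V} (hw : w ∈ D.weyl) :
    coroot i (w (α i)) = A i i → w (α i) = α i := by
  refine D.imaginary_descent hi (P := fun w => coroot i (w (α i)) = A i i → w (α i) = α i)
    (fun w _ h _ => h) (fun w hw j hj ih h => ?_) hw
  · have hle := D.coroot_apply_imaginary_le hi (mul_mem (D.s_mem_weyl j) hw)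
    have hij : (A i j : ℚ) ≤ 0 := by exact_mod_cast D.nonpos i j (imaginary_ne_real hi j)
    have hexp : coroot i ((D.s j * w) (α i)) = A i i - coroot j (w (α i)) * A i j := by
      rw [LinearEquiv.mul_apply, s_apply, map_sub, map_smul, h, D.pairing, smul_eq_mul]
    have h0 : A i j = 0 := by
      rcases hij.lt_or_eq with hlt | heq
      · nlinarith
      · exact_mod_cast heq
    have h1 := ih (by rw [hexp, h0]; simp)
    have h2 : w (α i) = D.s j (α i) := by
      conv_rhs => rw [← h1, ← LinearEquiv.mul_apply, ← mul_assoc, s_mul_self, one_mul]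
    rw [h2, s_apply, D.pairing, (D.zero_iff i j).1 h0]
    simp

/-- If `α_i^∨` vanishes on `w α_k`, with `i` imaginary, then `(w α_k)^∨` vanishes on `α_i`. -/
theorem coroot_inv_apply_eq_zero {i : I} (hi : A i i ≠ 2) {w : V ≃ₗ[ℚ] V} (hw : w ∈ D.weyl)
    {k : I} : coroot i (w (α k)) = 0 → coroot k (w⁻¹ (α i)) = 0 := by
  have hreal : ∀ j : RealIndex A, ∀ w ∈ D.weyl, coroot i (w (α j)) = 0 →
      coroot j (w⁻¹ (α i)) = 0 := by
    intro j w hw h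
    have hu : w * D.s j * w⁻¹ ∈ D.weyl := mul_mem (mul_mem hw (D.s_mem_weyl j)) (inv_mem hw)
    have hexp : (w * D.s j * w⁻¹) (α i) = α i - coroot j (w⁻¹ (α i)) • w (α j) := by
      rw [LinearEquiv.mul_apply, LinearEquiv.mul_apply, s_apply, map_sub, map_smul,
        ← LinearEquiv.mul_apply w, mul_inv_cancel]; rfl
    have := D.apply_imaginary_eq hi hu (by
      rw [hexp, map_sub, map_smul, h, D.pairing]; simp)
    rw [hexp, sub_eq_self, smul_eq_zero] at this
    exact this.resolve_right (D.apply_simple_ne_zero w j)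
  by_cases hk : A k k = 2
  · exact hreal ⟨k, hk⟩ w hw
  refine D.weyl_induction (P := fun w => coroot i (w (α k)) = 0 → coroot k (w⁻¹ (α i)) = 0)
    ?_ (fun w hw j hj ih h => ?_) hw
  · change coroot i (α k) = 0 → coroot k (α i) = 0
    rw [D.pairing, D.pairing]
    exact_mod_cast (D.zero_iff i k).1
  · have hjk : (A j k : ℚ) ≤ 0 := by exact_mod_cast D.nonpos j k (imaginary_ne_real hk j).symm
    have h1 := D.coroot_nonpos hi (D.apply_imaginary_mem hk hw)
    have h2 := D.coroot_nonpos hi (realCone_le_posCone A α hj)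
    rw [LinearEquiv.mul_apply, s_apply, D.pairing, map_sub, map_smul, map_sub, map_smul,
      smul_eq_mul] at h
    have h3 : coroot i (w (α k)) = 0 := by nlinarith
    rw [mul_inv_rev, s_inv, LinearEquiv.mul_apply, s_apply, map_sub, map_smul, ih h3, D.pairing,
      smul_eq_mul]
    rw [h3, zero_sub, neg_eq_zero, mul_eq_zero] at h
    rcases h with h | h
    · rw [(D.zero_iff j k).1 (by exact_mod_cast h)]; simp
    · rw [hreal j w hw h]; simp

end IsRealization
end GKM

namespace GKM

variable {I V : Type*} [AddCommGroup V] [Module ℚ V]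

section Orbit

variable {α : I → V} {coroot : I → (V →ₗ[ℚ] ℚ)} {lam : V}

theorem srefl_apply (i : I) (x : V) : srefl α coroot i x = x - coroot i x • α i := rfl

theorem reflRoot_apply (β : V) (βv : V →ₗ[ℚ] ℚ) (x : V) : reflRoot β βv x = x - βv x • β := rfl

theorem crefl_apply (i : I) (h : V →ₗ[ℚ] ℚ) (x : V) :
    crefl α coroot i h x = h (srefl α coroot i x) := by
  simp [crefl, srefl_apply, mul_comm]

theorem srefl_mem_Torbit {x : V} (hx : x ∈ Torbit α coroot lam) (i : I) :
    srefl α coroot i x ∈ Torbit α coroot lam := by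
  obtain ⟨τ, hτ, rfl⟩ := hx
  exact ⟨srefl α coroot i * τ, mul_mem (Submonoid.subset_closure ⟨i, rfl⟩) hτ, rfl⟩

theorem Torbit_induction {P : V → Prop} (base : P lam)
    (step : ∀ x ∈ Torbit α coroot lam, ∀ i, P x → P (srefl α coroot i x))
    {x : V} (hx : x ∈ Torbit α coroot lam) : P x := by
  obtain ⟨τ, hτ, rfl⟩ := hx
  induction hτ using Submonoid.closure_induction_left with
  | one => exact base
  | mul_left r hr τ hτ ih =>
    obtain ⟨i, rfl⟩ := hr
    exact step _ ⟨τ, hτ, rfl⟩ i ih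

end Orbit

namespace IsRealization

variable {A : I → I → ℤ} {α : I → V} {coroot : I → (V →ₗ[ℚ] ℚ)}
  (D : IsRealization A α coroot) {lam : V}

/-! ### Orbits of dominant weights -/

theorem exists_isWRootPres_iff {k : I} {β : V} {βv : V →ₗ[ℚ] ℚ} :
    (∃ l, IsWRootPres A α coroot l k β βv) ↔
      ∃ w ∈ D.weyl, β = w (α k) ∧ ∀ x, βv x = coroot k (w⁻¹ x) := by
  constructor
  · rintro ⟨l, hl, rfl, rfl⟩
    induction l with
    | nil => exact ⟨1, one_mem _, rfl, fun _ => rfl⟩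
    | cons m l ih =>
      obtain ⟨w, hw, h1, h2⟩ := ih fun j hj => hl j (List.mem_cons_of_mem _ hj)
      let j : RealIndex A := ⟨m, hl m List.mem_cons_self⟩
      refine ⟨D.s j * w, mul_mem (D.s_mem_weyl j) hw, ?_, fun x => ?_⟩
      · rw [List.map_cons, List.prod_cons, Module.End.mul_apply, h1]; rfl
      · rw [List.map_cons, List.prod_cons, Module.End.mul_apply, crefl_apply, h2, mul_inv_rev,
          s_inv]
        rfl
  · rintro ⟨w, hw, rfl, h⟩
    suffices H : ∃ l : List I, (∀ m ∈ l, A m m = 2) ∧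
        w (α k) = (l.map (srefl α coroot)).prod (α k) ∧
        ∀ x, coroot k (w⁻¹ x) = (l.map (crefl α coroot)).prod (coroot k) x by
      obtain ⟨l, h1, h2, h3⟩ := H
      exact ⟨l, h1, h2, LinearMap.ext fun x => (h x).trans (h3 x)⟩
    clear h
    have step : ∀ (j : RealIndex A) (w : V ≃ₗ[ℚ] V), (∃ l : List I, (∀ m ∈ l, A m m = 2) ∧
        w (α k) = (l.map (srefl α coroot)).prod (α k) ∧
        ∀ x, coroot k (w⁻¹ x) = (l.map (crefl α coroot)).prod (coroot k) x) →
        ∃ l : List I, (∀ m ∈ l, A m m = 2) ∧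
        (D.s j * w) (α k) = (l.map (srefl α coroot)).prod (α k) ∧
        ∀ x, coroot k ((D.s j * w)⁻¹ x) = (l.map (crefl α coroot)).prod (coroot k) x := by
      rintro j w ⟨l, h1, h2, h3⟩
      refine ⟨j :: l, by simpa using ⟨j.2, h1⟩, ?_, fun x => ?_⟩
      · rw [List.map_cons, List.prod_cons, Module.End.mul_apply, ← h2]; rfl
      · rw [List.map_cons, List.prod_cons, Module.End.mul_apply, crefl_apply, ← h3, mul_inv_rev,
          s_inv]
        rfl
    induction hw using Subgroup.closure_induction_left with
    | one => exact ⟨[], by simp, rfl, fun _ => rfl⟩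
    | mul_left y hy w _ ih =>
      obtain ⟨j, rfl⟩ := hy
      exact step j w ih
    | inv_mul_cancel y hy w _ ih =>
      obtain ⟨j, rfl⟩ := hy
      rw [s_inv]
      exact step j w ih

theorem weyl_mem_Torbit {x : V} (hx : x ∈ Torbit α coroot lam) {w : V ≃ₗ[ℚ] V}
    (hw : w ∈ D.weyl) : w x ∈ Torbit α coroot lam := by
  induction hw using Subgroup.closure_induction_left with
  | one => exact hx
  | mul_left y hy w _ ih =>
    obtain ⟨j, rfl⟩ := hy
    exact srefl_mem_Torbit ih j
  | inv_mul_cancel y hy w _ ih =>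
    obtain ⟨j, rfl⟩ := hy
    rw [s_inv]
    exact srefl_mem_Torbit ih j

theorem apply_inv_apply (w : V ≃ₗ[ℚ] V) (x : V) : w (w⁻¹ x) = x := by
  rw [← LinearEquiv.mul_apply, mul_inv_cancel]; rfl

theorem inv_apply_apply (w : V ≃ₗ[ℚ] V) (x : V) : w⁻¹ (w x) = x := by
  rw [← LinearEquiv.mul_apply, inv_mul_cancel]; rfl

theorem s_mul_inv_apply (j : RealIndex A) (w : V ≃ₗ[ℚ] V) (x : V) :
    (D.s j * w)⁻¹ (D.s j x) = w⁻¹ x := by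
  rw [← LinearEquiv.mul_apply, mul_inv_rev, inv_mul_cancel_right]

theorem s_s_apply (j : RealIndex A) (x : V) : D.s j (D.s j x) = x := by
  rw [← LinearEquiv.mul_apply, s_mul_self]; rfl

theorem sub_apply_mem_posCone (hlam : lam ∈ Pplus coroot) {x : V}
    (hx : x ∈ Torbit α coroot lam) :
    ∀ w ∈ D.weyl, lam - w x ∈ posCone α := by
  refine Torbit_induction (P := fun x => ∀ w ∈ D.weyl, lam - w x ∈ posCone α) ?_
    (fun x _ i ih w hw => ?_) hx
  · intro w hw
    have := D.apply_sub_mem_of_antidominant (x := -lam) (fun j => ?_) hw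
    · rw [map_neg, sub_neg_eq_add, neg_add_eq_sub] at this
      exact realCone_le_posCone A α this
    · obtain ⟨n, hn⟩ := hlam.1 j
      have hn0 : 0 ≤ n := by exact_mod_cast hn ▸ hlam.2 j
      lift n to ℕ using hn0
      exact ⟨n, by rw [map_neg, hn]; simp⟩
  · by_cases hi : A i i = 2
    · exact ih _ (mul_mem hw (D.s_mem_weyl ⟨i, hi⟩))
    have h1 := ih 1 (one_mem _)
    change lam - x ∈ posCone α at h1
    obtain ⟨m, hm⟩ := D.exists_int_coroot h1 i
    obtain ⟨n, hn⟩ := hlam.1 i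
    have h2 := D.coroot_nonpos hi h1
    have h3 := hlam.2 i
    have h4 : coroot i x = ((n - m : ℤ) : ℚ) := by
      rw [map_sub] at hm; push_cast; linarith
    have h5 : 0 ≤ n - m := by
      have : (0 : ℚ) ≤ ((n - m : ℤ) : ℚ) := by push_cast; linarith
      exact_mod_cast this
    obtain ⟨q, hq⟩ := Int.eq_ofNat_of_zero_le h5
    have h6 : lam - w (srefl α coroot i x) = (lam - w x) + q • w (α i) := by
      rw [srefl_apply, h4, hq, map_sub, map_smul, ← Nat.cast_smul_eq_nsmul ℚ]
      push_cast; module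
    rw [h6]
    exact add_mem (ih w hw) (nsmul_mem (D.apply_imaginary_mem hi hw) q)

theorem coroot_nonneg (D : IsRealization A α coroot) (hlam : lam ∈ Pplus coroot) {i : I}
    (hi : A i i ≠ 2) {x : V}
    (hx : x ∈ Torbit α coroot lam) : 0 ≤ coroot i x := by
  have h1 := D.coroot_nonpos hi (D.sub_apply_mem_posCone hlam hx 1 (one_mem _))
  change coroot i (lam - x) ≤ 0 at h1
  have h2 := hlam.2 i
  rw [map_sub] at h1
  linarith

theorem nonpos_of_transvection (hlam : lam ∈ Pplus coroot) {u : V ≃ₗ[ℚ] V} (hu : u ∈ D.weyl)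
    {m : I} {f : V →ₗ[ℚ] ℚ} (hf : f (α m) = 0) (h : ∀ x, u x = x + f x • α m) {x : V}
    (hx : x ∈ Torbit α coroot lam) : f x ≤ 0 := by
  have hpow : ∀ n : ℕ, (u ^ n) x = x + (n * f x) • α m := by
    intro n
    induction n with
    | zero => simp
    | succ n ih =>
      rw [pow_succ', LinearEquiv.mul_apply, ih, h, map_add, map_smul, hf]
      push_cast; module
  by_contra! hpos
  obtain ⟨n, hn⟩ := exists_nat_gt (D.height (lam - x) / f x)
  have h1 := D.height_nonneg (D.sub_apply_mem_posCone hlam hx _ (pow_mem hu n))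
  rw [hpow, ← sub_sub, map_sub, map_smul, height_simple, smul_eq_mul, mul_one] at h1
  rw [div_lt_iff₀ hpos] at hn
  linarith

theorem eq_zero_of_transvection (hlam : lam ∈ Pplus coroot) {u : V ≃ₗ[ℚ] V} (hu : u ∈ D.weyl)
    {m : I} {f : V →ₗ[ℚ] ℚ} (hf : f (α m) = 0) (h : ∀ x, u x = x + f x • α m) {x : V}
    (hx : x ∈ Torbit α coroot lam) : f x = 0 := by
  refine le_antisymm (D.nonpos_of_transvection hlam hu hf h hx) ?_
  have := D.nonpos_of_transvection hlam (inv_mem hu) (f := -f) (m := m) (by simp [hf])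
    (fun y => ?_) hx
  · simpa using this
  · apply u.injective
    rw [apply_inv_apply, h, LinearMap.neg_apply, map_add, map_smul, hf]
    module

theorem exists_smul_of_sub_mem (D : IsRealization A α coroot) {m : I} {q : ℚ} {x : V}
    (hx : x ∈ posCone α) (h : q • α m - x ∈ posCone α) : ∃ c : ℚ, x = c • α m := by
  classical
  obtain ⟨f, hf⟩ := D.exists_dual fun i => if i = m then 0 else 1
  have hnonneg : ∀ {y : V}, y ∈ posCone α → 0 ≤ f y := by
    intro y hy
    induction hy using AddSubmonoid.closure_induction with
    | mem y hy => obtain ⟨i, rfl⟩ := hy; rw [hf]; split_ifs <;> norm_num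
    | zero => simp
    | add y z _ _ hy hz => rw [map_add]; exact add_nonneg hy hz
  have hx0 : f x ≤ 0 := by
    have := hnonneg h
    rw [map_sub, map_smul, hf] at this
    simpa using this
  clear h
  induction hx using AddSubmonoid.closure_induction with
  | mem x hx =>
    obtain ⟨i, rfl⟩ := hx
    rw [hf] at hx0
    split_ifs at hx0 with h
    · exact ⟨1, by rw [h, one_smul]⟩
    · norm_num at hx0
  | zero => exact ⟨0, by simp⟩
  | add x y hx hy ihx ihy =>
    have h1 := hnonneg hx
    have h2 := hnonneg hy
    rw [map_add] at hx0
    obtain ⟨c, rfl⟩ := ihx (by linarith)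
    obtain ⟨d, rfl⟩ := ihy (by linarith)
    exact ⟨c + d, by rw [add_smul]⟩

/-! ### Chains -/

/-- `y = r_γ z` with `γ` a positive root and `γ^∨(z) > 0`. -/
def Step (lam y z : V) : Prop :=
  z ∈ Torbit α coroot lam ∧ ∃ k, ∃ w ∈ D.weyl, w (α k) ∈ posCone α ∧
    0 < coroot k (w⁻¹ z) ∧ y = z - coroot k (w⁻¹ z) • w (α k)

variable {D} in
theorem Step.left_mem {y z : V} (h : D.Step lam y z) : y ∈ Torbit α coroot lam := by
  obtain ⟨hz, k, w, hw, -, -, rfl⟩ := h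
  have := D.weyl_mem_Torbit (srefl_mem_Torbit (D.weyl_mem_Torbit hz (inv_mem hw)) k) hw
  rwa [srefl_apply, map_sub, map_smul, apply_inv_apply] at this

theorem step_s_apply {z : V} (hz : z ∈ Torbit α coroot lam) {j : RealIndex A}
    (h : 0 < coroot j z) : D.Step lam (D.s j z) z :=
  ⟨hz, j, 1, one_mem _, simple_mem_posCone α j, h, rfl⟩

theorem coroot_s_apply (j : RealIndex A) (x : V) : coroot j (D.s j x) = -coroot j x := by
  rw [s_apply, map_sub, map_smul, D.pairing, j.2, smul_eq_mul]; push_cast; ring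

theorem step_of_coroot_neg {y : V} (hy : y ∈ Torbit α coroot lam) {j : RealIndex A}
    (h : coroot j y < 0) : D.Step lam y (D.s j y) := by
  have := D.step_s_apply (D.weyl_mem_Torbit hy (D.s_mem_weyl j)) (j := j)
    (by rw [coroot_s_apply]; linarith)
  rwa [s_s_apply] at this

theorem step_imaginary {i : I} (hi : A i i ≠ 2) {w : V ≃ₗ[ℚ] V} (hw : w ∈ D.weyl) {z : V}
    (hz : z ∈ Torbit α coroot lam) (h : 0 < coroot i (w⁻¹ z)) :
    D.Step lam (z - coroot i (w⁻¹ z) • w (α i)) z :=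
  ⟨hz, i, w, hw, D.apply_imaginary_mem hi hw, h, rfl⟩

variable {D} in
theorem Step.s_apply (hlam : lam ∈ Pplus coroot) {y z : V} (h : D.Step lam y z)
    (j : RealIndex A) : D.Step lam (D.s j y) (D.s j z) ∨ y = D.s j z := by
  obtain ⟨hz, k, w, hw, hpos, h0, rfl⟩ := h
  by_cases hmem : (D.s j * w) (α k) ∈ posCone α
  · refine .inl ⟨D.weyl_mem_Torbit hz (D.s_mem_weyl j), k, D.s j * w,
      mul_mem (D.s_mem_weyl j) hw, hmem, ?_, ?_⟩
    · rwa [s_mul_inv_apply]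
    · rw [s_mul_inv_apply, map_sub, map_smul]; rfl
  have hjw := mul_mem (D.s_mem_weyl j) hw
  have hk : A k k = 2 := by
    by_contra hk
    exact hmem (D.apply_imaginary_mem hk hjw)
  have hneg := (D.apply_simple_mem_or_neg_mem hjw ⟨k, hk⟩).resolve_left
    fun h => hmem (realCone_le_posCone A α h)
  rw [LinearEquiv.mul_apply, D.s_apply, neg_sub] at hneg
  obtain ⟨c, hc⟩ := D.exists_smul_of_sub_mem hpos (realCone_le_posCone A α hneg)
  let γ : V →ₗ[ℚ] ℚ := coroot k ∘ₗ (w⁻¹ : V ≃ₗ[ℚ] V).toLinearMap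
  have hγ : ∀ x, γ x = coroot k (w⁻¹ x) := fun _ => rfl
  have hγj : c * γ (α j) = 2 := by
    rw [← smul_eq_mul, ← map_smul, ← hc, hγ, inv_apply_apply, D.pairing, hk]; norm_num
  have hf := D.eq_zero_of_transvection hlam (f := c • γ - coroot j) (m := j)
    (mul_mem (D.s_mem_weyl j) (mul_mem (mul_mem hw (D.s_mem_weyl ⟨k, hk⟩)) (inv_mem hw)))
    (by
      rw [LinearMap.sub_apply, LinearMap.smul_apply, smul_eq_mul, hγj, D.pairing, j.2]
      norm_num)
    (fun x => by
      have hx : (w * D.s ⟨k, hk⟩ * w⁻¹) x = x - (c * γ x) • α j := by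
        rw [LinearEquiv.mul_apply, LinearEquiv.mul_apply, D.s_apply, map_sub, map_smul,
          apply_inv_apply, hc, hγ]
        module
      rw [LinearEquiv.mul_apply, hx, map_sub, map_smul, s_simple, D.s_apply]
      simp only [LinearMap.sub_apply, LinearMap.smul_apply, smul_eq_mul]
      module) hz
  refine .inr ?_
  rw [LinearMap.sub_apply, LinearMap.smul_apply, smul_eq_mul, sub_eq_zero] at hf
  rw [hc, D.s_apply, ← hf, hγ]
  module

/-- There is a chain of length `p` from `z` to `y`. -/
def Chain (lam : V) : ℕ → V → V → Prop
  | 0, y, z => y = z ∧ z ∈ Torbit α coroot lam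
  | p + 1, y, z => ∃ x, D.Step lam y x ∧ Chain lam p x z

variable {D} in
theorem Step.chain {y z : V} (h : D.Step lam y z) : D.Chain lam 1 y z := ⟨z, h, rfl, h.1⟩

theorem exists_isChain_iff {p : ℕ} {y z : V} :
    (∃ c β βv, IsChain A α coroot lam y z p c β βv) ↔ D.Chain lam p y z := by
  induction p generalizing y with
  | zero =>
    constructor
    · rintro ⟨c, β, βv, rfl, rfl, h, -⟩
      exact ⟨rfl, h 0 le_rfl⟩
    · rintro ⟨rfl, h⟩
      exact ⟨fun _ => y, 0, 0, rfl, rfl, fun _ _ => h, by simp⟩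
  | succ p ih =>
    constructor
    · rintro ⟨c, β, βv, rfl, rfl, hc, h⟩
      refine ⟨c 1, ⟨hc 1 (by omega), ?_⟩, ih.1 ⟨fun n => c (n + 1), fun n => β (n + 1),
        fun n => βv (n + 1), rfl, rfl, fun k hk => hc _ (by omega), fun k hk => h _ (by omega)⟩⟩
      obtain ⟨⟨l, k, hl⟩, h2, h3, h4⟩ := h 0 (by omega)
      obtain ⟨w, hw, e1, e2⟩ := D.exists_isWRootPres_iff.1 ⟨l, hl⟩
      refine ⟨k, w, hw, ?_, ?_, ?_⟩
      · rw [← e1]; exact mem_Qplus_iff.1 h2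
      · rw [← e2]; exact h3
      · rw [← e1, ← e2]; exact h4
    · rintro ⟨x, hs, hx⟩
      obtain ⟨c, β, βv, rfl, rfl, hc, h⟩ := ih.2 hx
      have hy := hs.left_mem
      obtain ⟨-, k, w, hw, h2, h3, h4⟩ := hs
      let γ : V →ₗ[ℚ] ℚ := coroot k ∘ₗ (w⁻¹ : V ≃ₗ[ℚ] V).toLinearMap
      refine ⟨fun n => n.casesOn y c, fun n => n.casesOn (w (α k)) β,
        fun n => n.casesOn γ βv, rfl, rfl, ?_, ?_⟩
      · rintro (_ | n) hn
        · exact hy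
        · exact hc n (by omega)
      · rintro (_ | n) hn
        · obtain ⟨l, hl⟩ := D.exists_isWRootPres_iff.2 ⟨w, hw, rfl, fun x => (rfl : γ x = _)⟩
          exact ⟨⟨l, k, hl⟩, mem_Qplus_iff.2 h2, h3, h4⟩
        · exact h n (by omega)

theorem distEq_one_iff {y z : V} : distEq A α coroot lam y z 1 ↔
    D.Chain lam 1 y z ∧ ∀ p, D.Chain lam p y z → p ≤ 1 := by
  simp only [distEq, ← D.exists_isChain_iff, forall_exists_index]

variable {D} in
theorem Chain.s_apply (hlam : lam ∈ Pplus coroot) {p : ℕ} {y z : V} (h : D.Chain lam p y z)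
    (j : RealIndex A) : D.Chain lam p (D.s j y) (D.s j z) ∨
      ∃ q, p = q + 1 ∧ D.Chain lam q y (D.s j z) := by
  induction p generalizing y with
  | zero =>
    obtain ⟨rfl, hy⟩ := h
    exact .inl ⟨rfl, D.weyl_mem_Torbit hy (D.s_mem_weyl j)⟩
  | succ p ih =>
    obtain ⟨x, hs, hx⟩ := h
    rcases ih hx with h | ⟨q, rfl, h⟩
    · rcases hs.s_apply hlam j with h' | rfl
      · exact .inl ⟨_, h', h⟩
      · exact .inr ⟨p, rfl, h⟩
    · exact .inr ⟨q + 1, rfl, x, hs, h⟩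

/-! ### Coverings along imaginary roots -/

theorem coroot_apply_of_fix {i : I} (hi : A i i ≠ 2) {u : V ≃ₗ[ℚ] V} (hu : u ∈ D.weyl) :
    u (α i) = α i → ∀ x, coroot i (u x) = coroot i x := by
  refine D.weyl_induction (P := fun u => u (α i) = α i → ∀ x, coroot i (u x) = coroot i x)
    (fun _ _ => rfl) (fun u hu j hj ih h x => ?_) hu
  have hji := D.nonpos j i (imaginary_ne_real hi j).symm
  obtain ⟨n, hn⟩ := Int.eq_ofNat_of_zero_le (neg_nonneg.2 hji)
  have hA : (A j i : ℚ) = -(n : ℚ) := by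
    rw [← neg_eq_iff_eq_neg]; exact_mod_cast hn
  have h1 := realCone_le_posCone A α (D.apply_imaginary_sub_mem hi hu)
  have hsum : u (α i) - α i = -(n • u (α j)) := by
    rw [LinearEquiv.mul_apply, D.s_apply, D.pairing, hA, map_sub, map_smul] at h
    rw [← Nat.cast_smul_eq_nsmul ℚ, sub_eq_iff_eq_add]
    nth_rw 2 [← h]
    module
  have h2 : u (α i) - α i = 0 := D.eq_zero_of_neg_mem h1 (by
    rw [hsum, neg_neg]; exact nsmul_mem (realCone_le_posCone A α hj) n)
  have hn0 : n = 0 := by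
    rw [hsum, neg_eq_zero, ← Nat.cast_smul_eq_nsmul ℚ, smul_eq_zero, Nat.cast_eq_zero] at h2
    exact h2.resolve_right (D.apply_simple_ne_zero u j)
  have hij : A i j = 0 := (D.zero_iff i j).2 (by rw [hn0] at hA; exact_mod_cast hA)
  rw [LinearEquiv.mul_apply, ih (sub_eq_zero.1 h2), D.s_apply, map_sub, map_smul, D.pairing, hij]
  simp

theorem coroot_le_of_mem_Torbit (hlam : lam ∈ Pplus coroot) {i : I} (hi : A i i ≠ 2)
    {w : V ≃ₗ[ℚ] V} (hw : w ∈ D.weyl) {j : RealIndex A} (hj : 0 < coroot j (w (α i))) {x : V}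
    (hx : x ∈ Torbit α coroot lam) (h0 : 0 < coroot i (w⁻¹ x)) :
    coroot j x ≤ coroot i (w⁻¹ x) * coroot j (w (α i)) := by
  by_contra! hlt
  have hu : w⁻¹ * D.s j * w ∈ D.weyl := mul_mem (mul_mem (inv_mem hw) (D.s_mem_weyl j)) hw
  have hexp : (w⁻¹ * D.s j * w) (α i) = α i - coroot j (w (α i)) • w⁻¹ (α j) := by
    rw [LinearEquiv.mul_apply, LinearEquiv.mul_apply, D.s_apply, map_sub, map_smul,
      inv_apply_apply]
  have hne : w⁻¹ (α j) ≠ 0 := D.apply_simple_ne_zero _ _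
  have h1 := realCone_le_posCone A α (D.apply_imaginary_sub_mem hi hu)
  rw [hexp, sub_sub_cancel_left] at h1
  have hneg : -w⁻¹ (α j) ∈ realCone A α := by
    refine (D.apply_simple_mem_or_neg_mem (inv_mem hw) j).resolve_left fun h => hne ?_
    refine D.eq_zero_of_height_nonpos (realCone_le_posCone A α h) ?_
    have h2 := D.height_nonneg h1
    rw [map_neg, map_smul, smul_eq_mul] at h2
    by_contra! h3
    have := mul_pos hj h3
    linarith
  have hneg' := realCone_le_posCone A α hneg
  obtain ⟨d, hd⟩ := D.exists_int_coroot hneg' i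
  obtain ⟨k, hk⟩ := D.exists_int_coroot (D.apply_imaginary_mem hi hw) j
  have hd0 : d ≤ 0 := by exact_mod_cast hd ▸ D.coroot_nonpos hi hneg'
  have hd1 : d ≠ 0 := by
    rintro rfl
    rw [map_neg, Int.cast_zero, neg_eq_zero] at hd
    have := D.apply_imaginary_eq hi hu (by
      rw [hexp, map_sub, map_smul, hd, D.pairing]; simp)
    rw [hexp, sub_eq_self, smul_eq_zero] at this
    exact this.elim hj.ne' hne
  have hdle : (d : ℚ) ≤ -1 := by
    have : d ≤ -1 := by omega
    exact_mod_cast this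
  have hk1 : (1 : ℚ) ≤ k := by
    rw [hk] at hj
    have : 0 < k := by exact_mod_cast hj
    exact_mod_cast this
  have h3 := D.coroot_nonneg hlam hi
    (D.weyl_mem_Torbit (D.weyl_mem_Torbit hx (D.s_mem_weyl j)) (inv_mem hw))
  rw [D.s_apply, map_sub, map_smul, map_sub, map_smul, smul_eq_mul] at h3
  rw [map_neg, neg_eq_iff_eq_neg] at hd
  rw [hd] at h3
  rw [hk] at hlt
  have h4 : coroot i (w⁻¹ x) ≤ coroot i (w⁻¹ x) * k := le_mul_of_one_le_right h0.le hk1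
  nlinarith

theorem coroot_inv_apply_le (hlam : lam ∈ Pplus coroot) {i : I} (hi : A i i ≠ 2)
    {w : V ≃ₗ[ℚ] V} (hw : w ∈ D.weyl) : ∀ x ∈ Torbit α coroot lam, 0 < coroot i (w⁻¹ x) →
      (∀ p, D.Chain lam p (x - coroot i (w⁻¹ x) • w (α i)) x → p ≤ 1) →
      coroot i (w⁻¹ x) ≤ coroot i x := by
  refine D.imaginary_descent hi (P := fun w => ∀ x ∈ Torbit α coroot lam,
    0 < coroot i (w⁻¹ x) → (∀ p, D.Chain lam p (x - coroot i (w⁻¹ x) • w (α i)) x → p ≤ 1) →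
    coroot i (w⁻¹ x) ≤ coroot i x) ?_ ?_ hw
  · intro w hw h x _ _ _
    rw [← D.coroot_apply_of_fix hi hw h (w⁻¹ x), apply_inv_apply]
  intro w hw j hj ih x hx h0 hcov
  have hstep := D.step_imaginary hi hw hx h0
  have hjx := D.weyl_mem_Torbit hx (D.s_mem_weyl j)
  have hstep' := D.step_imaginary hi (mul_mem (D.s_mem_weyl j) hw) hjx
    (by rwa [s_mul_inv_apply])
  rw [s_mul_inv_apply] at hstep'
  specialize ih _ hjx (by rwa [s_mul_inv_apply])
  rw [s_mul_inv_apply] at ih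
  set n := coroot i (w⁻¹ x) with hn
  set μ := x - n • w (α i) with hμ
  have hs : D.s j x - n • (D.s j * w) (α i) = D.s j μ := by
    rw [hμ, map_sub, map_smul]; rfl
  rw [hs] at hstep' ih
  have hle := D.coroot_le_of_mem_Torbit hlam hi hw hj hx h0
  have hcμ : coroot j μ = coroot j x - n * coroot j (w (α i)) := by
    rw [hμ, map_sub, map_smul, smul_eq_mul]
  have hnk := mul_pos h0 hj
  have hlt : coroot j x < 0 := by
    by_contra! hge
    rcases (sub_nonpos.2 hle).lt_or_eq with hM | hM
    · have h1 := D.step_of_coroot_neg hstep.left_mem (j := j) (by rw [hcμ]; exact hM)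
      rcases hge.lt_or_eq with hX | hX
      · have := hcov 3 ⟨_, h1, _, hstep', (D.step_s_apply hx hX).chain⟩
        omega
      · have hxx : D.s j x = x := by rw [D.s_apply, ← hX]; simp
        rw [hxx] at hstep'
        have := hcov 2 ⟨_, h1, hstep'.chain⟩
        omega
    · have hμμ : D.s j μ = μ := by rw [D.s_apply, hcμ, hM]; simp
      rw [hμμ] at hstep'
      have := hcov 2 ⟨_, hstep', (D.step_s_apply hx (by linarith)).chain⟩
      omega
  have hstepμ := D.step_of_coroot_neg hstep.left_mem (j := j) (by rw [hcμ]; linarith)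
  have := ih fun p hp => by
    rcases hp.s_apply hlam j with h | ⟨q, rfl, h⟩
    · rw [s_s_apply, s_s_apply] at h
      exact hcov p h
    · rw [s_s_apply] at h
      exact hcov _ ⟨_, hstepμ, h⟩
  have hij : (A i j : ℚ) ≤ 0 := by exact_mod_cast D.nonpos i j (imaginary_ne_real hi j)
  rw [D.s_apply, map_sub, map_smul, D.pairing, smul_eq_mul] at this
  nlinarith

variable {D} in
theorem Step.coroot_le {i : I} (hi : A i i ≠ 2) {y z : V} (h : D.Step lam y z) :
    coroot i z ≤ coroot i y := by
  obtain ⟨-, k, w, -, hpos, h0, rfl⟩ := h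
  have := mul_nonpos_of_nonneg_of_nonpos h0.le (D.coroot_nonpos hi hpos)
  rw [map_sub, map_smul, smul_eq_mul]
  linarith

variable {D} in
theorem Chain.coroot_le {i : I} (hi : A i i ≠ 2) {p : ℕ} {y z : V} (h : D.Chain lam p y z) :
    coroot i z ≤ coroot i y := by
  induction p generalizing y with
  | zero => rw [h.1]
  | succ p ih =>
    obtain ⟨x, hs, hx⟩ := h
    exact (ih hx).trans (hs.coroot_le hi)

variable {D} in
theorem Chain.srefl_apply {i : I} (hi : A i i ≠ 2) {p : ℕ} {y z : V} (h : D.Chain lam p y z)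
    (heq : coroot i y = coroot i z) :
    D.Chain lam p (srefl α coroot i y) (srefl α coroot i z) := by
  induction p generalizing y with
  | zero => exact ⟨by rw [h.1], srefl_mem_Torbit h.2 i⟩
  | succ p ih =>
    obtain ⟨x, hs, hx⟩ := h
    have h1 := hx.coroot_le hi
    have h2 := hs.coroot_le hi
    refine ⟨_, ?_, ih hx (by linarith)⟩
    have hxy : coroot i y = coroot i x := by linarith
    obtain ⟨hxT, k, w, hw, hpos, h0, rfl⟩ := hs
    have hz : coroot i (w (α k)) = 0 := by
      rw [map_sub, map_smul, sub_eq_self, smul_eq_zero] at hxy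
      exact hxy.resolve_left h0.ne'
    have hk := D.coroot_inv_apply_eq_zero hi hw hz
    have he : coroot k (w⁻¹ (srefl α coroot i x)) = coroot k (w⁻¹ x) := by
      rw [GKM.srefl_apply, map_sub, map_smul, map_sub, map_smul, hk]; simp
    refine ⟨srefl_mem_Torbit hxT i, k, w, hw, hpos, by rwa [he], ?_⟩
    rw [he, map_sub, map_smul, GKM.srefl_apply i (w (α k)), hz]
    module

end IsRealization

theorem ofFn_prod_apply (f : ℕ → Module.End ℚ V) (d : ℕ → V) (n : ℕ)
    (h : ∀ k < n, d k = f k (d (k + 1))) :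
    (List.ofFn fun q : Fin n => f q).prod (d n) = d 0 := by
  induction n generalizing f d with
  | zero => rfl
  | succ n ih =>
    rw [List.ofFn_succ, List.prod_cons, Module.End.mul_apply, h 0 n.succ_pos]
    exact congrArg _ (ih (fun k => f (k + 1)) (fun k => d (k + 1)) fun k hk => h _ (by omega))

end GKM

open GKM in
/-- If along an `a`-chain for `(μ, ν)` some root `β_l` is a `W`-translate of an
imaginary simple root `α_i` and `a α_i^∨(μ) = 1 - a_{ii}`, then `β_l = α_i`, `r_i`
commutes with the earlier step reflections, `μ = r_i μ'` where
`μ' = r_{β_1} ⋯ r_{β_{l-1}} ν_l`, and there is an `a`-chain for `(μ', ν)`.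
(Here the index `l0` is `l - 1` in `0`-based counting, so `β_l` is `β l0` and
`ν_l = c (l0 + 1)`.) -/
theorem stmt12 {I V : Type*} [Countable I] [AddCommGroup V] [Module ℚ V]
    (A : I → I → ℤ) (α : I → V) (coroot : I → (V →ₗ[ℚ] ℚ))
    (hind : LinearIndependent ℚ α)
    (hpair : ∀ i j, coroot i (α j) = (A i j : ℚ))
    (hdiag : ∀ i, A i i = 2 ∨ A i i ≤ 0)
    (hoff : ∀ i j, i ≠ j → A i j ≤ 0)
    (hzero : ∀ i j, A i j = 0 ↔ A j i = 0)
    (lam : V) (hlam : lam ∈ Pplus coroot)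
    (a : ℚ) (ha0 : 0 < a) (ha1 : a ≤ 1)
    (μ ν : V) (s : ℕ) (c : ℕ → V) (β : ℕ → V) (βv : ℕ → (V →ₗ[ℚ] ℚ)) (ks : ℕ → I)
    (hchain : IsAChain A α coroot lam a μ ν s c β βv ks)
    (l0 : ℕ) (hl0 : l0 < s)
    (him : A (ks l0) (ks l0) ≠ 2)
    (hval : a * coroot (ks l0) μ = 1 - (A (ks l0) (ks l0) : ℚ)) :
    β l0 = α (ks l0) ∧
    (∀ q < l0, srefl α coroot (ks l0) * reflRoot (β q) (βv q) =
        reflRoot (β q) (βv q) * srefl α coroot (ks l0)) ∧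
    (let μ' : V :=
      ((List.ofFn fun q : Fin l0 => reflRoot (β q.val) (βv q.val)).prod) (c (l0 + 1));
     μ = μ' - coroot (ks l0) μ' • α (ks l0) ∧
     (μ' = ν ∨ HasAChain A α coroot lam a μ' ν)) := by
  have D : IsRealization A α coroot := ⟨hind, hpair, hdiag, hoff, hzero⟩
  obtain ⟨-, ⟨rfl, rfl, hc, hch⟩, hcov⟩ := hchain
  have hroot := fun k hk => D.exists_isWRootPres_iff.1 (hcov k hk).1
  have hpos : ∀ k < s, β k ∈ posCone α := fun k hk => mem_Qplus_iff.1 (hch k hk).2.1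
  have hstep : ∀ k < s, c k = c (k + 1) - βv k (c (k + 1)) • β k := fun k hk => (hch k hk).2.2.2
  obtain ⟨i, hi⟩ : ∃ i, i = ks l0 := ⟨_, rfl⟩
  rw [← hi] at him hval ⊢
  have hcoroot : ∀ k < s,
      coroot i (c k) = coroot i (c (k + 1)) - βv k (c (k + 1)) * coroot i (β k) := fun k hk => by
    conv_lhs => rw [hstep k hk, map_sub, map_smul, smul_eq_mul]
  have hsucc : ∀ k < s, coroot i (c (k + 1)) ≤ coroot i (c k) := fun k hk => by
    rw [hcoroot k hk]
    linarith [mul_nonpos_of_nonneg_of_nonpos (hch k hk).2.2.1.le (D.coroot_nonpos him (hpos k hk))]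
  have hanti : ∀ p q, p ≤ q → q ≤ s → coroot i (c q) ≤ coroot i (c p) := fun p q hpq => by
    induction q, hpq using Nat.le_induction with
    | base => exact fun _ => le_rfl
    | succ q _ ih => exact fun h => (hsucc q h).trans (ih (by omega))
  have hn : βv l0 (c (l0 + 1)) = 1 / a := by
    rw [eq_div_iff ha0.ne', mul_comm]
    exact (hcov l0 hl0).2.2.2 (by rwa [← hi])
  have ha : 0 < 1 / a := by positivity
  have hval' : coroot i (c 0) = 1 / a - 1 / a * A i i := by
    field_simp; linarith
  have hle : 1 / a ≤ coroot i (c (l0 + 1)) ∧ coroot i (β l0) ≤ A i i := by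
    obtain ⟨w, hw, h1, h2⟩ := hroot l0 hl0
    rw [← hi] at h1 h2
    refine ⟨?_, h1 ▸ D.coroot_apply_imaginary_le him hw⟩
    have := D.coroot_inv_apply_le hlam him hw _ (hc _ hl0) (by rw [← h2, hn]; exact ha)
      (by
        rw [← h1, ← h2, ← hstep l0 hl0]
        exact (D.distEq_one_iff.1 (hcov l0 hl0).2.1).2)
    rwa [← h2, hn] at this
  have hl := hcoroot l0 hl0
  rw [hn] at hl
  have hconst : ∀ q ≤ l0, coroot i (c q) = coroot i (c 0) := fun q hq => by
    have h1 := hanti 0 q (Nat.zero_le q) (by omega)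
    have h2 := hanti q l0 hq hl0.le
    nlinarith [mul_le_mul_of_nonneg_left hle.2 ha.le]
  have hβ : β l0 = α i := by
    obtain ⟨w, hw, h1, -⟩ := hroot l0 hl0
    rw [← hi] at h1
    rw [h1]
    refine D.apply_imaginary_eq him hw (h1 ▸ le_antisymm hle.2 ?_)
    rw [hconst l0 le_rfl, hval'] at hl
    refine le_of_mul_le_mul_left ?_ ha
    linarith [hle.1]
  have hzeroβ : ∀ q < l0, coroot i (β q) = 0 := fun q hq => by
    have := hcoroot q (by omega)
    rw [hconst q hq.le, hconst (q + 1) hq, eq_comm, sub_eq_self, mul_eq_zero] at this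
    exact this.resolve_left (hch q (by omega)).2.2.1.ne'
  have hzeroβv : ∀ q < l0, βv q (α i) = 0 := fun q hq => by
    obtain ⟨w, hw, h1, h2⟩ := hroot q (by omega)
    rw [h2]
    exact D.coroot_inv_apply_eq_zero him hw (h1 ▸ hzeroβ q hq)
  refine ⟨hβ, fun q hq => LinearMap.ext fun x => ?_, ?_⟩
  · simp only [Module.End.mul_apply, reflRoot_apply, srefl_apply, map_sub, map_smul,
      hzeroβ q hq, hzeroβv q hq]
    module
  let d : ℕ → V := fun k => if k ≤ l0 then c k + (1 / a) • α i else c (k + 1)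
  have hd_le : ∀ k ≤ l0, d k = c k + (1 / a) • α i := fun k hk => if_pos hk
  have hd_ge : ∀ k, l0 ≤ k → d k = c (k + 1) := fun k hk => by
    rcases hk.eq_or_lt with rfl | hk
    · rw [hd_le _ le_rfl, hstep _ hl0, hn, hβ, sub_add_cancel]
    · exact if_neg (by omega)
  have hβvd : ∀ k < l0, βv k (d (k + 1)) = βv k (c (k + 1)) := fun k hk => by
    rw [hd_le _ hk, map_add, map_smul, hzeroβv k hk]; simp
  have hdstep : ∀ k < l0, d k = d (k + 1) - βv k (d (k + 1)) • β k := fun k hk => by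
    rw [hβvd k hk, hd_le k hk.le, hd_le _ hk, hstep k (by omega)]; module
  have hprod := ofFn_prod_apply (fun q => reflRoot (β q) (βv q)) d l0 hdstep
  rw [hd_ge l0 le_rfl] at hprod
  have hcd : ∀ k ≤ l0, coroot i (d k) = 1 / a := fun k hk => by
    rw [hd_le k hk, map_add, map_smul, hpair, hconst k hk, hval', smul_eq_mul]; ring
  have hsrefl : ∀ k ≤ l0, srefl α coroot i (d k) = c k := fun k hk => by
    rw [srefl_apply, hcd k hk, hd_le k hk, add_sub_cancel_right]
  have hdStep : ∀ k < l0, d (k + 1) ∈ Torbit α coroot lam →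
      D.Step lam (d k) (d (k + 1)) := fun k hk h => by
    obtain ⟨w, hw, h1, h2⟩ := hroot k (by omega)
    refine ⟨h, ks k, w, hw, h1 ▸ hpos k (by omega), ?_, ?_⟩
    · rw [← h2, hβvd k hk]; exact (hch k (by omega)).2.2.1
    · rw [← h1, ← h2]; exact hdstep k hk
  have hdT : ∀ k ≤ l0, d k ∈ Torbit α coroot lam := fun k hk => by
    induction hk using Nat.decreasingInduction with
    | self => rw [hd_ge _ le_rfl]; exact hc _ hl0
    | of_succ k hk ih => exact (hdStep k hk ih).left_mem
  intro μ'
  have hμ' : μ' = d 0 := hprod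
  rw [hμ']
  refine ⟨(hsrefl 0 (Nat.zero_le _)).symm, ?_⟩
  obtain ⟨t, rfl⟩ : ∃ t, s = t + 1 := ⟨s - 1, by omega⟩
  rcases Nat.eq_zero_or_pos t with rfl | ht
  · exact .inl (hd_ge 0 (by omega))
  refine .inr ⟨t, d, fun k => if k < l0 then β k else β (k + 1),
    fun k => if k < l0 then βv k else βv (k + 1), fun k => if k < l0 then ks k else ks (k + 1),
    ht, ⟨rfl, hd_ge t (by omega), fun k hk => ?_, fun k hk => ?_⟩, fun k hk => ?_⟩
  · rcases le_total k l0 with h | h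
    · exact hdT k h
    · rw [hd_ge k h]; exact hc _ (by omega)
  · beta_reduce
    split_ifs with h
    · obtain ⟨h1, h2, h3, -⟩ := hch k (by omega)
      exact ⟨h1, h2, by rwa [hβvd k h], hdstep k h⟩
    · rw [hd_ge k (by omega), hd_ge (k + 1) (by omega)]
      exact hch (k + 1) (by omega)
  · beta_reduce
    split_ifs with h
    · obtain ⟨h1, h2, h3, h4⟩ := hcov k (by omega)
      rw [hβvd k h]
      refine ⟨h1, D.distEq_one_iff.2 ⟨(hdStep k h (hdT _ h)).chain, fun p hp => ?_⟩, h3, h4⟩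
      have := hp.srefl_apply him (by rw [hcd k h.le, hcd _ h])
      rw [hsrefl k h.le, hsrefl _ h] at this
      exact (D.distEq_one_iff.1 h2).2 p this
    · rw [hd_ge k (by omega), hd_ge (k + 1) (by omega)]
      exact hcov (k + 1) (by omega)
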